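/- Up to isomorphism, there are exactly 5 orientable vertex-transitive equivelar maps of Schläfli type {3,7} with Euler characteristic −2 that are neither regular nor chiral. -/

import Mathlib

/-- A map: a finite nonempty set of flags with three fixed-point-free involutions
`s0, s1, s2` such that `s0 * s2` is also a fixed-point-free involution and the
group generated by them acts transitively on the flags. -/
structure CMap (F : Type) [Fintype F] where
  nonempty : Nonempty F
  s0 : Equiv.Perm F
  s1 : Equiv.Perm F
  s2 : Equiv.Perm F
  invol0 : s0 * s0 = 1
  invol1 : s1 * s1 = 1
  invol2 : s2 * s2 = 1
  fpf0 : ∀ x, s0 x ≠ x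
  fpf1 : ∀ x, s1 x ≠ x
  fpf2 : ∀ x, s2 x ≠ x
  invol02 : (s0 * s2) * (s0 * s2) = 1
  fpf02 : ∀ x, s0 (s2 x) ≠ x
  conn : ∀ x y : F, ∃ g ∈ Subgroup.closure ({s0, s1, s2} : Set (Equiv.Perm F)), g x = y

namespace CMap

variable {F : Type} [Fintype F]

/-- The automorphism group of a map: all permutations of the flags commuting
with each of `s0, s1, s2`. -/
def aut (M : CMap F) : Subgroup (Equiv.Perm F) :=
  Subgroup.centralizer {M.s0, M.s1, M.s2}

/-- The vertex containing a flag `x`: the orbit of `x` under `⟨s1, s2⟩`. -/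
def vertexOf (M : CMap F) (x : F) : Set F :=
  MulAction.orbit (Subgroup.closure ({M.s1, M.s2} : Set (Equiv.Perm F))) x

/-- The edge containing a flag `x`: the orbit of `x` under `⟨s0, s2⟩`. -/
def edgeOf (M : CMap F) (x : F) : Set F :=
  MulAction.orbit (Subgroup.closure ({M.s0, M.s2} : Set (Equiv.Perm F))) x

/-- The face containing a flag `x`: the orbit of `x` under `⟨s0, s1⟩`. -/
def faceOf (M : CMap F) (x : F) : Set F :=
  MulAction.orbit (Subgroup.closure ({M.s0, M.s1} : Set (Equiv.Perm F))) x

/-- The orbit of a flag under the automorphism group. -/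
def flagOrbit (M : CMap F) (x : F) : Set F :=
  MulAction.orbit M.aut x

noncomputable def numVertices (M : CMap F) : ℕ := Nat.card (Set.range M.vertexOf)

noncomputable def numEdges (M : CMap F) : ℕ := Nat.card (Set.range M.edgeOf)

noncomputable def numFaces (M : CMap F) : ℕ := Nat.card (Set.range M.faceOf)

/-- The Euler characteristic `V - E + F` of a map. -/
noncomputable def euler (M : CMap F) : ℤ :=
  (M.numVertices : ℤ) - (M.numEdges : ℤ) + (M.numFaces : ℤ)

/-- The number of orbits of the automorphism group on flags. -/
noncomputable def numFlagOrbits (M : CMap F) : ℕ := Nat.card (Set.range M.flagOrbit)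

/-- `M` is a `k`-orbit map if its automorphism group has exactly `k` orbits on flags. -/
def IsKOrbit (M : CMap F) (k : ℕ) : Prop := M.numFlagOrbits = k

/-- A map is regular if it is a 1-orbit map. -/
def IsRegular (M : CMap F) : Prop := M.IsKOrbit 1

/-- A map is chiral if it is a 2-orbit map in which every flag lies in a
different automorphism orbit from each of its images under `s0, s1, s2`. -/
def IsChiral (M : CMap F) : Prop :=
  M.IsKOrbit 2 ∧ ∀ x : F,
    M.s0 x ∉ M.flagOrbit x ∧ M.s1 x ∉ M.flagOrbit x ∧ M.s2 x ∉ M.flagOrbit x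

/-- A map is vertex-transitive if its automorphism group acts transitively on vertices. -/
def VertexTransitive (M : CMap F) : Prop :=
  ∀ x y : F, ∃ g ∈ M.aut, M.vertexOf (g x) = M.vertexOf y

/-- A map is edge-transitive if its automorphism group acts transitively on edges. -/
def EdgeTransitive (M : CMap F) : Prop :=
  ∀ x y : F, ∃ g ∈ M.aut, M.edgeOf (g x) = M.edgeOf y

/-- `M` is equivelar of Schläfli type `{p, q}`: every face has exactly `2p` flags
and every vertex has exactly `2q` flags. -/
def Equivelar (M : CMap F) (p q : ℕ) : Prop :=
  (∀ x : F, Nat.card (M.faceOf x) = 2 * p) ∧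
  (∀ x : F, Nat.card (M.vertexOf x) = 2 * q)

/-- A map is orientable if the flags can be partitioned into two classes so that
each of `s0, s1, s2` maps each class into the other. -/
def Orientable (M : CMap F) : Prop :=
  ∃ A : Set F,
    (∀ x, M.s0 x ∈ A ↔ x ∉ A) ∧ (∀ x, M.s1 x ∈ A ↔ x ∉ A) ∧ (∀ x, M.s2 x ∈ A ↔ x ∉ A)

end CMap

/-- Two maps are isomorphic if there is a bijection between their flag sets
commuting with the respective involutions. -/
def CMap.Isomorphic {F F' : Type} [Fintype F] [Fintype F'] (M : CMap F) (N : CMap F') : Prop :=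
  ∃ e : F ≃ F',
    (∀ x, e (M.s0 x) = N.s0 (e x)) ∧ (∀ x, e (M.s1 x) = N.s1 (e x)) ∧
    (∀ x, e (M.s2 x) = N.s2 (e x))

/-- The property: vertex-transitive equivelar map of Schläfli type `{3, 7}` with
Euler characteristic `-2` that is neither regular nor chiral. -/
def GoodMap {F : Type} [Fintype F] (M : CMap F) : Prop :=
  M.VertexTransitive ∧ M.Equivelar 3 7 ∧ M.euler = -2 ∧
    ¬ M.IsRegular ∧ ¬ M.IsChiral

section Dihedral

variable {F : Type} {a b : Equiv.Perm F}

theorem apply_apply_of_mul_self (ha : a * a = 1) (x : F) : a (a x) = x := by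
  rw [← Equiv.Perm.mul_apply, ha, Equiv.Perm.one_apply]

/-- A set preserved by a family of permutations is preserved by the subgroup they generate. -/
theorem apply_mem_iff_of_mem_closure {S : Set (Equiv.Perm F)} {T : Set F}
    (hS : ∀ s ∈ S, ∀ y, s y ∈ T ↔ y ∈ T) {g : Equiv.Perm F}
    (hg : g ∈ Subgroup.closure S) (y : F) : g y ∈ T ↔ y ∈ T := by
  induction hg using Subgroup.closure_induction generalizing y with
  | mem s hs => exact hS s hs y
  | one => simp
  | mul g h _ _ ihg ihh => rw [Equiv.Perm.mul_apply, ihg, ihh]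
  | inv g _ ih => rw [← ih, ← Equiv.Perm.mul_apply, mul_inv_cancel, Equiv.Perm.one_apply]

theorem apply_mem_iff_of_mul_self {T : Set F} (ha : a * a = 1) (h : ∀ y ∈ T, a y ∈ T) (y : F) :
    a y ∈ T ↔ y ∈ T :=
  ⟨fun hy => by simpa [apply_apply_of_mul_self ha] using h _ hy, h y⟩

theorem orbit_closure_pair (ha : a * a = 1) (hb : b * b = 1) (x : F) :
    MulAction.orbit (Subgroup.closure ({a, b} : Set (Equiv.Perm F))) x =
      MulAction.orbit (Subgroup.zpowers (a * b)) x ∪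
        b '' MulAction.orbit (Subgroup.zpowers (a * b)) x := by
  have h1 : a ∈ Subgroup.closure ({a, b} : Set (Equiv.Perm F)) :=
    Subgroup.subset_closure (by simp)
  have h2 : b ∈ Subgroup.closure ({a, b} : Set (Equiv.Perm F)) :=
    Subgroup.subset_closure (by simp)
  have h3 : Subgroup.zpowers (a * b) ≤ Subgroup.closure ({a, b} : Set (Equiv.Perm F)) :=
    Subgroup.zpowers_le.2 (mul_mem h1 h2)
  have hba : a = b * (a * b)⁻¹ := by
    rw [mul_inv_rev, mul_inv_cancel_left, inv_eq_of_mul_eq_one_left ha]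
  have mem {y : F} {i : ℤ} : ((a * b) ^ i) y ∈ MulAction.orbit (Subgroup.zpowers (a * b)) y :=
    ⟨⟨_, i, rfl⟩, rfl⟩
  ext y
  constructor
  · rintro ⟨⟨g, hg⟩, rfl⟩
    refine (apply_mem_iff_of_mem_closure ?_ hg x).2 (Or.inl (MulAction.mem_orbit_self x))
    rintro s (rfl | rfl)
    · refine apply_mem_iff_of_mul_self ha ?_
      rintro _ (⟨⟨_, i, rfl⟩, rfl⟩ | ⟨_, ⟨⟨_, i, rfl⟩, rfl⟩, rfl⟩)
      · right
        refine ⟨_, mem (i := -1 + i), ?_⟩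
        rw [zpow_add, zpow_neg_one, Equiv.Perm.mul_apply, ← Equiv.Perm.mul_apply, ← hba]
        rfl
      · left
        convert mem (i := 1 + i) using 1
        rw [zpow_add, zpow_one]
        rfl
    · refine apply_mem_iff_of_mul_self hb ?_
      rintro _ (h | ⟨y, h, rfl⟩)
      · exact Or.inr ⟨_, h, rfl⟩
      · left
        rwa [apply_apply_of_mul_self hb]
  · rintro (⟨⟨g, hg⟩, rfl⟩ | ⟨_, ⟨⟨g, hg⟩, rfl⟩, rfl⟩)
    · exact ⟨⟨g, h3 hg⟩, rfl⟩
    · exact ⟨⟨b * g, mul_mem h2 (h3 hg)⟩, rfl⟩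

/-- The orbits of a dihedral group whose generating involutions exchange `O` and its complement. -/
theorem card_orbit_closure_pair [Finite F] (ha : a * a = 1) (hb : b * b = 1) {O : Set F}
    (hOa : ∀ x, a x ∈ O ↔ x ∉ O) (hOb : ∀ x, b x ∈ O ↔ x ∉ O) (x : F) :
    Nat.card (MulAction.orbit (Subgroup.closure ({a, b} : Set (Equiv.Perm F))) x) =
      2 * Function.minimalPeriod (a * b) x := by
  have hO : ∀ y ∈ MulAction.orbit (Subgroup.zpowers (a * b)) x, (y ∈ O ↔ x ∈ O) := by
    rintro _ ⟨⟨g, hg⟩, rfl⟩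
    have hS : ∀ s ∈ ({a * b} : Set (Equiv.Perm F)), ∀ y, s y ∈ O ↔ y ∈ O := by
      rintro _ rfl y
      rw [Equiv.Perm.mul_apply, hOa, hOb, not_not]
    rw [Subgroup.zpowers_eq_closure] at hg
    exact apply_mem_iff_of_mem_closure hS hg x
  have hper : Function.minimalPeriod (a * b) x =
      (MulAction.orbit (Subgroup.zpowers (a * b)) x).ncard := by
    have := Fintype.ofFinite (MulAction.orbit (Subgroup.zpowers (a * b)) x)
    rw [← Nat.card_coe_set_eq, Nat.card_eq_fintype_card]
    exact MulAction.minimalPeriod_eq_card (a * b) x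
  rw [Nat.card_coe_set_eq, orbit_closure_pair ha hb, Set.ncard_union_eq,
    Set.ncard_image_of_injective _ b.injective, hper, two_mul]
  · rw [Set.disjoint_left]
    rintro _ h1 ⟨y, h2, rfl⟩
    have := hO _ h1
    rw [hOb, ← hO y h2] at this
    tauto

/-- Counting the orbits of a subgroup all of whose orbits have the same size. -/
theorem card_range_orbit_mul [Finite F] (K : Subgroup (Equiv.Perm F)) {m : ℕ}
    (h : ∀ x : F, Nat.card (MulAction.orbit K x) = m) :
    Nat.card (Set.range fun x : F => MulAction.orbit K x) * m = Nat.card F := by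
  classical
  have hf : ∀ t : Set.range fun x : F => MulAction.orbit K x,
      Nat.card {x : F // Set.rangeFactorization (fun x : F => MulAction.orbit K x) x = t} = m := by
    rintro ⟨_, y, rfl⟩
    rw [← h y]
    refine Nat.card_congr (Equiv.subtypeEquivRight fun x => ?_)
    rw [Subtype.ext_iff, ← MulAction.orbit_eq_iff]
    rfl
  rw [← Nat.card_congr (Equiv.sigmaFiberEquiv
    (Set.rangeFactorization fun x : F => MulAction.orbit K x))]
  have := Fintype.ofFinite (Set.range fun x : F => MulAction.orbit K x)
  rw [Nat.card_sigma, Finset.sum_congr rfl fun t _ => hf t]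
  simp

end Dihedral

namespace CMap

variable {F : Type} [Fintype F] (M : CMap F)

theorem s0_s0 (x : F) : M.s0 (M.s0 x) = x := apply_apply_of_mul_self M.invol0 x

theorem s1_s1 (x : F) : M.s1 (M.s1 x) = x := apply_apply_of_mul_self M.invol1 x

theorem s2_s2 (x : F) : M.s2 (M.s2 x) = x := apply_apply_of_mul_self M.invol2 x

theorem s0_s2 (x : F) : M.s0 (M.s2 x) = M.s2 (M.s0 x) := by
  have h := congrArg (fun g : Equiv.Perm F => g (M.s2 (M.s0 x))) M.invol02
  simpa [s0_s0, s2_s2] using h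

theorem mem_aut {M : CMap F} {g : Equiv.Perm F} :
    g ∈ M.aut ↔ (∀ x, g (M.s0 x) = M.s0 (g x)) ∧ (∀ x, g (M.s1 x) = M.s1 (g x)) ∧
      ∀ x, g (M.s2 x) = M.s2 (g x) := by
  simp only [aut, Subgroup.mem_centralizer_iff, Set.mem_insert_iff, Set.mem_singleton_iff,
    forall_eq_or_imp, forall_eq]
  simp only [Equiv.ext_iff, Equiv.Perm.mul_apply, eq_comm]

/-- A set of flags exchanged with its complement by each of `s0, s1, s2`. -/
def IsOrientation (O : Set F) : Prop :=
  (∀ x, M.s0 x ∈ O ↔ x ∉ O) ∧ (∀ x, M.s1 x ∈ O ↔ x ∉ O) ∧ (∀ x, M.s2 x ∈ O ↔ x ∉ O)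

/-- The rotation about the vertex of a flag. -/
def rot : Equiv.Perm F := M.s1 * M.s2

theorem rot_apply (x : F) : M.rot x = M.s1 (M.s2 x) := rfl

variable {M}

section Counting

variable {O : Set F}

theorem card_faceOf (hO : M.IsOrientation O) (x : F) :
    Nat.card (M.faceOf x) = 2 * Function.minimalPeriod (M.s0 * M.s1) x :=
  card_orbit_closure_pair M.invol0 M.invol1 hO.1 hO.2.1 x

theorem card_vertexOf (hO : M.IsOrientation O) (x : F) :
    Nat.card (M.vertexOf x) = 2 * Function.minimalPeriod M.rot x :=
  card_orbit_closure_pair M.invol1 M.invol2 hO.2.1 hO.2.2 x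

theorem card_edgeOf (hO : M.IsOrientation O) (x : F) : Nat.card (M.edgeOf x) = 4 := by
  have hx : Function.minimalPeriod (M.s0 * M.s2) x = 2 := by
    refine Function.minimalPeriod_eq_prime ?_ (M.fpf02 x)
    simp [Function.IsPeriodicPt, Function.IsFixedPt, s0_s2, s0_s0, s2_s2]
  rw [edgeOf, card_orbit_closure_pair M.invol0 M.invol2 hO.1 hO.2.2, hx]

theorem equivelar_iff (hO : M.IsOrientation O) :
    M.Equivelar 3 7 ↔ (∀ x, Function.minimalPeriod (M.s0 * M.s1) x = 3) ∧
      ∀ x, Function.minimalPeriod M.rot x = 7 := by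
  simp only [Equivelar, card_faceOf hO, card_vertexOf hO]
  exact and_congr (forall_congr' fun x => by lia) (forall_congr' fun x => by lia)

theorem euler_eq_neg_two_iff (hO : M.IsOrientation O) (h : M.Equivelar 3 7) :
    M.euler = -2 ↔ Nat.card F = 168 := by
  have hV : M.numVertices * (2 * 7) = Nat.card F := card_range_orbit_mul _ h.2
  have hE : M.numEdges * 4 = Nat.card F := card_range_orbit_mul _ (card_edgeOf hO)
  have hF : M.numFaces * (2 * 3) = Nat.card F := card_range_orbit_mul _ h.1
  rw [euler]
  lia

end Counting

theorem vertexOf_eq_iff {x y : F} : M.vertexOf x = M.vertexOf y ↔ x ∈ M.vertexOf y :=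
  MulAction.orbit_eq_iff

theorem rot_iterate_mem_vertexOf (n : ℕ) (x : F) : M.rot^[n] x ∈ M.vertexOf x := by
  rw [vertexOf, orbit_closure_pair M.invol1 M.invol2]
  exact Or.inl ⟨⟨M.rot ^ n, n, zpow_natCast _ n⟩, by
    rw [Equiv.Perm.iterate_eq_pow]
    rfl⟩

theorem s2_rot_iterate_mem_vertexOf (n : ℕ) (x : F) : M.s2 (M.rot^[n] x) ∈ M.vertexOf x := by
  rw [vertexOf, orbit_closure_pair M.invol1 M.invol2]
  exact Or.inr ⟨M.rot^[n] x, ⟨⟨M.rot ^ n, n, zpow_natCast _ n⟩, by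
    rw [Equiv.Perm.iterate_eq_pow]
    rfl⟩, rfl⟩

theorem mem_flagOrbit {x y : F} : y ∈ M.flagOrbit x ↔ ∃ g ∈ M.aut, g x = y :=
  ⟨fun ⟨g, hg⟩ => ⟨g, g.2, hg⟩, fun ⟨g, hg, h⟩ => ⟨⟨g, hg⟩, h⟩⟩

theorem flagOrbit_eq_iff {x y : F} : M.flagOrbit x = M.flagOrbit y ↔ ∃ g ∈ M.aut, g y = x :=
  MulAction.orbit_eq_iff.trans mem_flagOrbit

theorem flagOrbit_eq_of_isRegular (h : M.IsRegular) (x y : F) : M.flagOrbit x = M.flagOrbit y := by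
  have := (Nat.card_eq_one_iff_unique.1 h).1
  exact congrArg Subtype.val
    (Subsingleton.elim (⟨_, x, rfl⟩ : Set.range M.flagOrbit) ⟨_, y, rfl⟩)

theorem flagOrbit_rot_of_isChiral (h : M.IsChiral) (x : F) :
    M.flagOrbit (M.rot x) = M.flagOrbit x := by
  obtain ⟨h2, hne⟩ := h
  have hn {y z : F} (h : z ∉ M.flagOrbit y) : M.flagOrbit z ≠ M.flagOrbit y := fun he =>
    h (he ▸ MulAction.mem_orbit_self z)
  have h1 := hn (hne x).2.2
  have h3 := hn (hne (M.s2 x)).2.1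
  by_contra h4
  rw [IsKOrbit, numFlagOrbits, Nat.card_coe_set_eq] at h2
  have h5 : ({M.flagOrbit x, M.flagOrbit (M.s2 x), M.flagOrbit (M.rot x)} : Set (Set F)).ncard
      = 3 := by
    rw [Set.ncard_eq_three]
    exact ⟨_, _, _, h1.symm, Ne.symm h4, h3.symm, rfl⟩
  have h6 : ({M.flagOrbit x, M.flagOrbit (M.s2 x), M.flagOrbit (M.rot x)} : Set (Set F)) ⊆
      Set.range M.flagOrbit := by
    rintro _ (rfl | rfl | rfl) <;> exact ⟨_, rfl⟩
  have := Set.ncard_le_ncard h6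
  lia

variable (M) in
/-- The flag reached from `x` by alternately applying `s0` and rotating about a vertex through
the prescribed numbers of steps. -/
def walk (w : List ℕ) (x : F) : F :=
  w.foldr (fun k y => M.rot^[k] (M.s0 y)) x

theorem goodMap_of {O : Set F} (hO : M.IsOrientation O) (hcard : Nat.card F = 168)
    (hF : ∀ x, Function.minimalPeriod (M.s0 * M.s1) x = 3)
    (hV : ∀ x, Function.minimalPeriod M.rot x = 7) (hT : M.VertexTransitive)
    {w : List ℕ} {x : F} (h1 : M.walk w x = x) (h2 : M.walk w (M.rot x) ≠ M.rot x) :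
    GoodMap M := by
  have he := (equivelar_iff hO).2 ⟨hF, hV⟩
  have key : ¬ M.flagOrbit (M.rot x) = M.flagOrbit x := by
    rw [flagOrbit_eq_iff]
    rintro ⟨g, hg, hgx⟩
    obtain ⟨g0, g1, g2⟩ := mem_aut.1 hg
    have hw : ∀ w y, g (M.walk w y) = M.walk w (g y) := by
      intro w y
      induction w with
      | nil => rfl
      | cons k w ih =>
        have : Function.Semiconj g M.rot M.rot := fun z => by simp [rot_apply, g1, g2]
        change g (M.rot^[k] (M.s0 (M.walk w y))) = M.rot^[k] (M.s0 (M.walk w (g y)))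
        rw [(this.iterate_right k).eq, g0, ih]
    rw [← hgx, ← hw, h1] at h2
    exact h2 rfl
  exact ⟨hT, he, (euler_eq_neg_two_iff hO he).2 hcard,
    fun h => key (flagOrbit_eq_of_isRegular h _ _), fun h => key (flagOrbit_rot_of_isChiral h x)⟩

end CMap

/-- The flags at a vertex of degree seven: `(i, b)` lies on the `i`-th dart, on the side `b`. -/
abbrev Corner := Fin 7 × Bool

namespace Corner

def s1 (l : Corner) : Corner := bif l.2 then (l.1 + 1, false) else (l.1 - 1, true)

def s2 (l : Corner) : Corner := (l.1, !l.2)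

def rot (l : Corner) : Corner := s1 (s2 l)

theorem s1_s1 : ∀ l, s1 (s1 l) = l := by decide

theorem s2_s2 : ∀ l, s2 (s2 l) = l := by decide

theorem s1_ne : ∀ l, s1 l ≠ l := by decide

theorem s2_ne : ∀ l, s2 l ≠ l := by decide

theorem rot_ne : ∀ l, rot l ≠ l := by decide

theorem rot_iterate_seven : ∀ l, rot^[7] l = l := by decide

theorem exists_eq_rot : ∀ l l' : Corner,
    ∃ n : Fin 7, l' = rot^[n] l ∨ l' = s2 (rot^[n] l) := by decide

end Corner

/-- The way the darts at a vertex are matched by the edges of a map, up to the action of a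
group regular on the vertices: `pair` matches the darts, and `flip` tells whether the sides are
exchanged. -/
@[ext]
structure DartPairing where
  pair : Fin 7 → Fin 7
  flip : Fin 7 → Bool

def DartPairing.s0 (P : DartPairing) (l : Corner) : Corner :=
  (P.pair l.1, Bool.xor l.2 (P.flip l.1))

/-- A dart pairing with voltages in a group. -/
structure VoltagePairing (G : Type) extends DartPairing where
  volt : Fin 7 → G

namespace VoltagePairing

section Steps

variable {G : Type} [Group G] (D : VoltagePairing G)

def s0 (x : G × Corner) : G × Corner := (x.1 * D.volt x.2.1, D.toDartPairing.s0 x.2)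

def s1 (x : G × Corner) : G × Corner := (x.1, x.2.s1)

def s2 (x : G × Corner) : G × Corner := (x.1, x.2.s2)

def walk (w : List ℕ) (x : G × Corner) : G × Corner :=
  w.foldr (fun k y => (fun z => s1 (s2 z))^[k] (D.s0 y)) x

def translate (g : G) (x : G × Corner) : G × Corner := (g * x.1, x.2)

variable {D}

theorem s0_translate (g : G) (x : G × Corner) : D.s0 (translate g x) = translate g (D.s0 x) := by
  simp [s0, translate, mul_assoc]

theorem walk_translate (w : List ℕ) (g : G) (x : G × Corner) :
    D.walk w (translate g x) = translate g (D.walk w x) := by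
  induction w with
  | nil => rfl
  | cons k w ih =>
    have : Function.Semiconj (translate g) (fun z => s1 (s2 z)) (fun z => s1 (s2 z)) :=
      fun _ => rfl
    change (fun z => s1 (s2 z))^[k] (D.s0 (D.walk w (translate g x))) =
      translate g ((fun z => s1 (s2 z))^[k] (D.s0 (D.walk w x)))
    rw [(this.iterate_right k).eq, ih, s0_translate]

theorem eq_translate (x : G × Corner) : x = translate x.1 (1, x.2) := by
  simp [translate]

variable (D) in
/-- The voltages define an orientable map of type `{3, 7}`. -/
structure IsAdmissible : Prop where
  pair_pair : ∀ i, D.pair (D.pair i) = i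
  flip_pair : ∀ i, D.flip (D.pair i) = D.flip i
  volt_mul_volt : ∀ i, D.volt i * D.volt (D.pair i) = 1
  volt_ne_one : ∀ i, D.pair i = i → D.volt i ≠ 1
  face : ∀ l, (fun x => D.s0 (s1 x))^[3] (1, l) = (1, l)
  face_ne : ∀ l, D.s0 (s1 (1, l)) ≠ (1, l)
  generate : ∃ p q r, ∀ g, ∃ (n : Fin 12) (m : Fin 3) (k : Fin 2),
    g = D.volt p ^ (n : ℕ) * D.volt q ^ (m : ℕ) * D.volt r ^ (k : ℕ)
  orient : ∃ κ : G → Bool, ∀ g i, κ (g * D.volt i) = Bool.xor (κ g) (!D.flip i)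

namespace IsAdmissible

variable (h : D.IsAdmissible)
include h

theorem s0_s0 : Function.Involutive D.s0 := by
  rintro ⟨g, i, b⟩
  simp [s0, DartPairing.s0, h.pair_pair, h.flip_pair, mul_assoc, h.volt_mul_volt]

theorem s0_ne (x : G × Corner) : D.s0 x ≠ x := by
  obtain ⟨g, i, b⟩ := x
  intro he
  simp only [s0, DartPairing.s0, Prod.mk.injEq, mul_eq_left] at he
  exact h.volt_ne_one i he.2.1 he.1

theorem s0_s2_s0_s2 (x : G × Corner) : D.s0 (s2 (D.s0 (s2 x))) = x := by
  obtain ⟨g, i, b⟩ := x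
  simp [s0, s2, Corner.s2, DartPairing.s0, h.pair_pair, h.flip_pair, mul_assoc, h.volt_mul_volt]

theorem s0_s2_ne (x : G × Corner) : D.s0 (s2 x) ≠ x := by
  obtain ⟨g, i, b⟩ := x
  intro he
  simp only [s0, s2, Corner.s2, DartPairing.s0, Prod.mk.injEq, mul_eq_left] at he
  exact h.volt_ne_one i he.2.1 he.1

/-- A set of flags closed under the three involutions is everything. -/
theorem eq_univ {S : Set (G × Corner)} (x : G × Corner) (hx : x ∈ S)
    (h0 : ∀ x ∈ S, D.s0 x ∈ S) (h1 : ∀ x ∈ S, s1 x ∈ S) (h2 : ∀ x ∈ S, s2 x ∈ S)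
    (y : G × Corner) : y ∈ S := by
  have hvert : ∀ g l l', (g, l) ∈ S → (g, l') ∈ S := by
    intro g l l' hl
    have hrot : ∀ n : ℕ, (g, Corner.rot^[n] l) ∈ S := by
      intro n
      induction n with
      | zero => exact hl
      | succ n ih =>
        rw [Function.iterate_succ_apply']
        exact h1 _ (h2 _ ih)
    obtain ⟨n, rfl | rfl⟩ := Corner.exists_eq_rot l l'
    · exact hrot n
    · exact h2 _ (hrot n)
  have hvolt : ∀ i g, (∀ l, (g, l) ∈ S) → ∀ l, (g * D.volt i, l) ∈ S := fun i g hg l =>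
    hvert _ _ _ (h0 (g, (i, false)) (hg _))
  have hpow : ∀ i (n : ℕ) g, (∀ l, (g, l) ∈ S) → ∀ l, (g * D.volt i ^ n, l) ∈ S := by
    intro i n
    induction n with
    | zero => simp
    | succ n ih =>
      intro g hg
      rw [pow_succ, ← mul_assoc]
      exact hvolt i _ (ih g hg)
  obtain ⟨p, q, r, hgen⟩ := h.generate
  obtain ⟨n, m, k, he⟩ := hgen (x.1⁻¹ * y.1)
  have := hpow r k _ (hpow q m _ (hpow p n x.1 fun l => hvert _ x.2 l hx)) y.2
  rwa [mul_assoc, mul_assoc, ← mul_assoc (D.volt p ^ _), ← he, mul_inv_cancel_left] at this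

end IsAdmissible

end Steps

section Map

variable {G F : Type} {D : VoltagePairing G}

/-- The permutation of `F` corresponding to an involution under a bijection. -/
def permOf {T : Type} (e : F ≃ T) (f : T → T) (hf : Function.Involutive f) : Equiv.Perm F :=
  e.symm.permCongr hf.toPerm

theorem apply_permOf {T : Type} (e : F ≃ T) (f : T → T) (hf : Function.Involutive f) (x : F) :
    e (permOf e f hf x) = f (e x) := by
  simp [permOf]

theorem permOf_mul_self {T : Type} (e : F ≃ T) (f : T → T) (hf : Function.Involutive f) :
    permOf e f hf * permOf e f hf = 1 :=
  Equiv.ext fun x => e.injective (by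
    rw [Equiv.Perm.mul_apply, apply_permOf, apply_permOf, hf, Equiv.Perm.one_apply])

theorem s1_involutive : Function.Involutive (s1 : G × Corner → G × Corner) := fun x => by
  simp [s1, Corner.s1_s1]

theorem s2_involutive : Function.Involutive (s2 : G × Corner → G × Corner) := fun x => by
  simp [s2, Corner.s2_s2]

variable [Group G] [Fintype F]

/-- The map derived from an admissible voltage pairing, its flags being relabelled by `e`. -/
def toMap (h : D.IsAdmissible) (e : F ≃ G × Corner) : CMap F where
  nonempty := ⟨e.symm (1, 0, false)⟩
  s0 := permOf e D.s0 h.s0_s0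
  s1 := permOf e s1 s1_involutive
  s2 := permOf e s2 s2_involutive
  invol0 := permOf_mul_self _ _ _
  invol1 := permOf_mul_self _ _ _
  invol2 := permOf_mul_self _ _ _
  fpf0 x hx := h.s0_ne (e x) (by rw [← apply_permOf e _ h.s0_s0, hx])
  fpf1 x hx := Corner.s1_ne (e x).2 (congrArg Prod.snd
    (((apply_permOf e s1 s1_involutive x).symm.trans (congrArg e hx))))
  fpf2 x hx := Corner.s2_ne (e x).2 (congrArg Prod.snd
    (((apply_permOf e s2 s2_involutive x).symm.trans (congrArg e hx))))
  invol02 := Equiv.ext fun x => e.injective (by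
    simp only [Equiv.Perm.mul_apply]
    rw [apply_permOf e, apply_permOf e, apply_permOf e, apply_permOf e, h.s0_s2_s0_s2,
      Equiv.Perm.one_apply])
  fpf02 x hx := h.s0_s2_ne (e x) (by
    rw [← apply_permOf e s2 s2_involutive, ← apply_permOf e _ h.s0_s0, hx])
  conn x y := by
    have key := h.eq_univ (S := {z | ∃ g ∈ Subgroup.closure {permOf e D.s0 h.s0_s0,
      permOf e s1 s1_involutive, permOf e s2 s2_involutive}, e (g x) = z}) (e x)
      ⟨1, one_mem _, rfl⟩ ?_ ?_ ?_ (e y)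
    · obtain ⟨g, hg, hgx⟩ := key
      exact ⟨g, hg, e.injective hgx⟩
    · rintro _ ⟨g, hg, rfl⟩
      exact ⟨permOf e D.s0 h.s0_s0 * g, mul_mem (Subgroup.subset_closure (by simp)) hg,
        apply_permOf _ _ _ _⟩
    · rintro _ ⟨g, hg, rfl⟩
      exact ⟨permOf e s1 s1_involutive * g, mul_mem (Subgroup.subset_closure (by simp)) hg,
        apply_permOf _ _ _ _⟩
    · rintro _ ⟨g, hg, rfl⟩
      exact ⟨permOf e s2 s2_involutive * g, mul_mem (Subgroup.subset_closure (by simp)) hg,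
        apply_permOf _ _ _ _⟩

variable (h : D.IsAdmissible) (e : F ≃ G × Corner)

theorem apply_toMap_s0 (x : F) : e ((toMap h e).s0 x) = D.s0 (e x) := apply_permOf _ _ _ _

theorem apply_toMap_s1 (x : F) : e ((toMap h e).s1 x) = s1 (e x) := apply_permOf _ _ _ _

theorem apply_toMap_s2 (x : F) : e ((toMap h e).s2 x) = s2 (e x) := apply_permOf _ _ _ _

theorem semiconj_toMap_rot : Function.Semiconj e (toMap h e).rot (fun z => s1 (s2 z)) := fun x => by
  rw [CMap.rot_apply, apply_toMap_s1, apply_toMap_s2]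

theorem apply_toMap_walk (w : List ℕ) (x : F) : e ((toMap h e).walk w x) = D.walk w (e x) := by
  induction w with
  | nil => rfl
  | cons k w ih =>
    change e ((toMap h e).rot^[k] ((toMap h e).s0 ((toMap h e).walk w x))) =
      (fun z => s1 (s2 z))^[k] (D.s0 (D.walk w (e x)))
    rw [((semiconj_toMap_rot h e).iterate_right k).eq, apply_toMap_s0, ih]

theorem apply_toMap_rot_iterate (n : ℕ) (x : F) :
    e ((toMap h e).rot^[n] x) = ((e x).1, Corner.rot^[n] (e x).2) := by
  rw [((semiconj_toMap_rot h e).iterate_right n).eq]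
  have : Function.Semiconj (Prod.mk (e x).1) Corner.rot
    (fun z : G × Corner => s1 (s2 z)) := fun _ => rfl
  rw [(this.iterate_right n).eq]

theorem exists_isOrientation_toMap : ∃ O, (toMap h e).IsOrientation O := by
  obtain ⟨κ, hκ⟩ := h.orient
  refine ⟨{x | Bool.xor (κ (e x).1) (e x).2.2 = true}, ?_, ?_, ?_⟩ <;> intro x
  · simp only [Set.mem_ofPred_eq, apply_toMap_s0, s0, DartPairing.s0, hκ]
    cases κ (e x).1 <;> cases (e x).2.2 <;> cases D.flip (e x).2.1 <;> decide
  · simp only [Set.mem_ofPred_eq, apply_toMap_s1, s1, Corner.s1]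
    cases κ (e x).1 <;> cases (e x).2.2 <;> simp
  · simp only [Set.mem_ofPred_eq, apply_toMap_s2, s2, Corner.s2]
    cases κ (e x).1 <;> cases (e x).2.2 <;> decide

theorem minimalPeriod_toMap_rot (x : F) : Function.minimalPeriod (toMap h e).rot x = 7 := by
  have : Fact (Nat.Prime 7) := ⟨by norm_num⟩
  refine Function.minimalPeriod_eq_prime (e.injective ?_) fun hx => ?_
  · rw [apply_toMap_rot_iterate, Corner.rot_iterate_seven]
  · have := apply_toMap_rot_iterate h e 1 x
    rw [Function.iterate_one, hx] at this
    exact Corner.rot_ne _ (congrArg Prod.snd this).symm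

theorem minimalPeriod_toMap_face (x : F) :
    Function.minimalPeriod ((toMap h e).s0 * (toMap h e).s1) x = 3 := by
  have : Fact (Nat.Prime 3) := ⟨by norm_num⟩
  have hs : Function.Semiconj e ((toMap h e).s0 * (toMap h e).s1) (fun x => D.s0 (s1 x)) :=
    fun x => by rw [Equiv.Perm.mul_apply, apply_toMap_s0, apply_toMap_s1]
  have ht : Function.Semiconj (translate (e x).1) (fun x => D.s0 (s1 x)) (fun x => D.s0 (s1 x)) :=
    fun y => (s0_translate _ (s1 y)).symm
  refine Function.minimalPeriod_eq_prime (e.injective ?_) fun hx => ?_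
  · rw [(hs.iterate_right 3).eq, eq_translate (e x), ← (ht.iterate_right 3).eq, h.face]
  · have := hs x
    rw [hx, eq_translate (e x), ← ht] at this
    refine h.face_ne (e x).2 (Prod.ext ?_ (congrArg Prod.snd this).symm)
    simpa [translate] using congrArg Prod.fst this

theorem vertexTransitive_toMap : (toMap h e).VertexTransitive := by
  intro x y
  let t : Equiv.Perm F := e.symm.permCongr
    ((Equiv.mulLeft ((e y).1 * (e x).1⁻¹)).prodCongr (Equiv.refl Corner))
  have ht : ∀ z, e (t z) = translate ((e y).1 * (e x).1⁻¹) (e z) := fun z => by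
    simp [t, translate]
    rfl
  refine ⟨t, CMap.mem_aut.2 ⟨fun z => e.injective ?_, fun z => e.injective ?_,
    fun z => e.injective ?_⟩, ?_⟩
  · rw [ht, apply_toMap_s0, apply_toMap_s0, ht, s0_translate]
  · rw [ht, apply_toMap_s1, apply_toMap_s1, ht]
    rfl
  · rw [ht, apply_toMap_s2, apply_toMap_s2, ht]
    rfl
  · rw [CMap.vertexOf_eq_iff]
    obtain ⟨n, hn | hn⟩ := Corner.exists_eq_rot (e y).2 (e x).2
    · have htx : t x = (toMap h e).rot^[n] y := e.injective (by
        rw [ht, apply_toMap_rot_iterate, ← hn]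
        simp [translate])
      exact htx ▸ CMap.rot_iterate_mem_vertexOf n y
    · have htx : t x = (toMap h e).s2 ((toMap h e).rot^[n] y) := e.injective (by
        rw [ht, apply_toMap_s2, apply_toMap_rot_iterate, s2, ← hn]
        simp [translate])
      exact htx ▸ CMap.s2_rot_iterate_mem_vertexOf n y

theorem goodMap_toMap (hF : Nat.card F = 168) {w : List ℕ}
    (hw : ∃ l, D.walk w (1, l) = (1, l) ∧ D.walk w (1, l.rot) ≠ (1, l.rot)) :
    GoodMap (toMap h e) ∧ (toMap h e).Orientable := by
  obtain ⟨l, h1, h2⟩ := hw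
  obtain ⟨O, hO⟩ := exists_isOrientation_toMap h e
  refine ⟨CMap.goodMap_of hO hF (minimalPeriod_toMap_face h e) (minimalPeriod_toMap_rot h e)
    (vertexTransitive_toMap h e) (w := w) (x := e.symm (1, l)) ?_ ?_, O, hO⟩
  · rw [← e.apply_eq_iff_eq, apply_toMap_walk, e.apply_symm_apply, h1]
  · have := apply_toMap_rot_iterate h e 1 (e.symm (1, l))
    rw [Function.iterate_one, e.apply_symm_apply, Function.iterate_one] at this
    rwa [Ne, ← e.apply_eq_iff_eq, apply_toMap_walk, this]

theorem exists_walk_toMap_eq_iff (w : List ℕ) :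
    (∃ x, (toMap h e).walk w x = x) ↔ ∃ l, D.walk w (1, l) = (1, l) := by
  constructor
  · rintro ⟨x, hx⟩
    rw [← e.apply_eq_iff_eq, apply_toMap_walk, eq_translate (e x), walk_translate] at hx
    refine ⟨(e x).2, Prod.ext ?_ (by simpa [translate] using congrArg Prod.snd hx)⟩
    simpa [translate] using congrArg Prod.fst hx
  · rintro ⟨l, hl⟩
    exact ⟨e.symm (1, l), by rw [← e.apply_eq_iff_eq, apply_toMap_walk, e.apply_symm_apply, hl]⟩

end Map

end VoltagePairing

namespace VoltagePairing

def cyclicOne : VoltagePairing (Multiplicative (ZMod 12)) where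
  pair := ![0, 2, 1, 6, 5, 4, 3]
  flip := ![true, true, true, true, false, false, true]
  volt := Multiplicative.ofAdd ∘ ![6, 4, 8, 2, 1, 11, 10]

def cyclicTwo : VoltagePairing (Multiplicative (ZMod 12)) where
  pair := ![0, 3, 6, 1, 5, 4, 2]
  flip := ![true, false, false, false, true, true, false]
  volt := Multiplicative.ofAdd ∘ ![6, 1, 5, 11, 4, 8, 7]

/-- The dart pairing of the maps on which a dihedral group is regular on the vertices. -/
def dihedralPairing : DartPairing where
  pair := ![0, 1, 6, 3, 5, 4, 2]
  flip _ := true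

open DihedralGroup in
def dihedralOne : VoltagePairing (DihedralGroup 6) where
  toDartPairing := dihedralPairing
  volt := ![r 3, sr 0, sr 3, sr 1, r 2, r 4, sr 3]

open DihedralGroup in
def dihedralTwo : VoltagePairing (DihedralGroup 6) where
  toDartPairing := dihedralPairing
  volt := ![sr 0, r 3, sr 3, sr 1, r 2, r 4, sr 3]

open DihedralGroup in
def dihedralThree : VoltagePairing (DihedralGroup 6) where
  toDartPairing := dihedralPairing
  volt := ![sr 0, sr 1, r 5, r 3, r 2, r 4, r 1]

theorem isAdmissible_cyclicOne : cyclicOne.IsAdmissible where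
  pair_pair := by decide
  flip_pair := by decide
  volt_mul_volt := by decide
  volt_ne_one := by decide
  face := by decide
  face_ne := by decide
  generate := ⟨4, 0, 0, by decide +kernel⟩
  orient := ⟨fun g => Nat.bodd (ZMod.val (Multiplicative.toAdd g)), by decide +kernel⟩

theorem isAdmissible_cyclicTwo : cyclicTwo.IsAdmissible where
  pair_pair := by decide
  flip_pair := by decide
  volt_mul_volt := by decide
  volt_ne_one := by decide
  face := by decide
  face_ne := by decide
  generate := ⟨1, 0, 0, by decide +kernel⟩
  orient := ⟨fun g => Nat.bodd (ZMod.val (Multiplicative.toAdd g)), by decide +kernel⟩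

theorem isAdmissible_dihedralOne : dihedralOne.IsAdmissible where
  pair_pair := by decide
  flip_pair := by decide
  volt_mul_volt := by decide
  volt_ne_one := by decide
  face := by decide
  face_ne := by decide
  generate := ⟨0, 4, 1, by decide +kernel⟩
  orient := ⟨fun _ => false, by decide⟩

theorem isAdmissible_dihedralTwo : dihedralTwo.IsAdmissible where
  pair_pair := by decide
  flip_pair := by decide
  volt_mul_volt := by decide
  volt_ne_one := by decide
  face := by decide
  face_ne := by decide
  generate := ⟨1, 4, 0, by decide +kernel⟩
  orient := ⟨fun _ => false, by decide⟩

theorem isAdmissible_dihedralThree : dihedralThree.IsAdmissible where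
  pair_pair := by decide
  flip_pair := by decide
  volt_mul_volt := by decide
  volt_ne_one := by decide
  face := by decide
  face_ne := by decide
  generate := ⟨2, 4, 0, by decide +kernel⟩
  orient := ⟨fun _ => false, by decide⟩

end VoltagePairing

namespace CMap

open VoltagePairing

noncomputable def finEquiv (G : Type) [Fintype G] (h : Fintype.card G = 12) :
    Fin 168 ≃ G × Corner :=
  (Fintype.equivFinOfCardEq (by simp [h])).symm

noncomputable def theMap : Fin 5 → CMap (Fin 168) := ![
  toMap isAdmissible_cyclicOne (finEquiv _ rfl),
  toMap isAdmissible_cyclicTwo (finEquiv _ rfl),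
  toMap isAdmissible_dihedralOne (finEquiv _ rfl),
  toMap isAdmissible_dihedralTwo (finEquiv _ rfl),
  toMap isAdmissible_dihedralThree (finEquiv _ rfl)]

theorem goodMap_theMap (i : Fin 5) : GoodMap (theMap i) ∧ (theMap i).Orientable := by
  fin_cases i
  · exact goodMap_toMap isAdmissible_cyclicOne _ (by simp) (w := [1, 1, 2, 2]) (by decide)
  · exact goodMap_toMap isAdmissible_cyclicTwo _ (by simp) (w := [1, 1, 2, 2]) (by decide)
  · exact goodMap_toMap isAdmissible_dihedralOne _ (by simp) (w := [2, 2, 3, 3]) (by decide)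
  · exact goodMap_toMap isAdmissible_dihedralTwo _ (by simp) (w := [2, 2, 2, 2]) (by decide)
  · exact goodMap_toMap isAdmissible_dihedralThree _ (by simp) (w := [1, 1, 2, 2]) (by decide)

theorem Isomorphic.exists_walk_eq_iff {F F' : Type} [Fintype F] [Fintype F'] {M : CMap F}
    {N : CMap F'} (h : M.Isomorphic N) (w : List ℕ) :
    (∃ x, M.walk w x = x) ↔ ∃ x, N.walk w x = x := by
  obtain ⟨e, e0, e1, e2⟩ := h
  have hr : Function.Semiconj e M.rot N.rot := fun x => by simp [rot_apply, e1, e2]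
  have hw : ∀ x, e (M.walk w x) = N.walk w (e x) := by
    intro x
    induction w with
    | nil => rfl
    | cons k w ih =>
      change e (M.rot^[k] (M.s0 (M.walk w x))) = N.rot^[k] (N.s0 (N.walk w (e x)))
      rw [(hr.iterate_right k).eq, e0, ih]
  rw [e.symm.exists_congr_left]
  exact exists_congr fun x => by rw [Equiv.symm_symm, ← hw, e.apply_eq_iff_eq]

/-- Which of three walks can be closed in each of the five maps. -/
theorem exists_walk_theMap_iff (i : Fin 5) :
    ((∃ x, (theMap i).walk [1, 1, 2, 2] x = x) ↔ i ∈ ({0, 1, 4} : Finset (Fin 5))) ∧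
    ((∃ x, (theMap i).walk [2, 2, 2, 2] x = x) ↔ i ∈ ({3, 4} : Finset (Fin 5))) ∧
    ((∃ x, (theMap i).walk [2, 2, 3, 3] x = x) ↔ i ∈ ({1, 2} : Finset (Fin 5))) := by
  fin_cases i
  · change ((∃ x, (toMap isAdmissible_cyclicOne (finEquiv _ rfl)).walk _ x = x) ↔ _) ∧
      ((∃ x, (toMap isAdmissible_cyclicOne (finEquiv _ rfl)).walk _ x = x) ↔ _) ∧
      ((∃ x, (toMap isAdmissible_cyclicOne (finEquiv _ rfl)).walk _ x = x) ↔ _)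
    simp only [exists_walk_toMap_eq_iff]
    decide
  · change ((∃ x, (toMap isAdmissible_cyclicTwo (finEquiv _ rfl)).walk _ x = x) ↔ _) ∧
      ((∃ x, (toMap isAdmissible_cyclicTwo (finEquiv _ rfl)).walk _ x = x) ↔ _) ∧
      ((∃ x, (toMap isAdmissible_cyclicTwo (finEquiv _ rfl)).walk _ x = x) ↔ _)
    simp only [exists_walk_toMap_eq_iff]
    decide
  · change ((∃ x, (toMap isAdmissible_dihedralOne (finEquiv _ rfl)).walk _ x = x) ↔ _) ∧
      ((∃ x, (toMap isAdmissible_dihedralOne (finEquiv _ rfl)).walk _ x = x) ↔ _) ∧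
      ((∃ x, (toMap isAdmissible_dihedralOne (finEquiv _ rfl)).walk _ x = x) ↔ _)
    simp only [exists_walk_toMap_eq_iff]
    decide
  · change ((∃ x, (toMap isAdmissible_dihedralTwo (finEquiv _ rfl)).walk _ x = x) ↔ _) ∧
      ((∃ x, (toMap isAdmissible_dihedralTwo (finEquiv _ rfl)).walk _ x = x) ↔ _) ∧
      ((∃ x, (toMap isAdmissible_dihedralTwo (finEquiv _ rfl)).walk _ x = x) ↔ _)
    simp only [exists_walk_toMap_eq_iff]
    decide
  · change ((∃ x, (toMap isAdmissible_dihedralThree (finEquiv _ rfl)).walk _ x = x) ↔ _) ∧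
      ((∃ x, (toMap isAdmissible_dihedralThree (finEquiv _ rfl)).walk _ x = x) ↔ _) ∧
      ((∃ x, (toMap isAdmissible_dihedralThree (finEquiv _ rfl)).walk _ x = x) ↔ _)
    simp only [exists_walk_toMap_eq_iff]
    decide

theorem eq_of_isomorphic_theMap (i j : Fin 5) (h : (theMap i).Isomorphic (theMap j)) : i = j := by
  obtain ⟨h1, h2, h3⟩ := exists_walk_theMap_iff i
  obtain ⟨k1, k2, k3⟩ := exists_walk_theMap_iff j
  rw [h.exists_walk_eq_iff, k1] at h1
  rw [h.exists_walk_eq_iff, k2] at h2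
  rw [h.exists_walk_eq_iff, k3] at h3
  have key : ∀ i j : Fin 5, (j ∈ ({0, 1, 4} : Finset (Fin 5)) ↔ i ∈ ({0, 1, 4} : Finset (Fin 5))) →
      (j ∈ ({3, 4} : Finset (Fin 5)) ↔ i ∈ ({3, 4} : Finset (Fin 5))) →
      (j ∈ ({1, 2} : Finset (Fin 5)) ↔ i ∈ ({1, 2} : Finset (Fin 5))) → i = j := by decide
  exact key i j h1 h2 h3

end CMap

namespace CMap

variable {F : Type} [Fintype F] {M : CMap F}

theorem conn_induction {P : F → Prop} {x : F} (hx : P x) (h0 : ∀ y, P y → P (M.s0 y))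
    (h1 : ∀ y, P y → P (M.s1 y)) (h2 : ∀ y, P y → P (M.s2 y)) (y : F) : P y := by
  obtain ⟨g, hg, rfl⟩ := M.conn x y
  refine (apply_mem_iff_of_mem_closure (T := {y | P y}) ?_ hg x).2 hx
  rintro s (rfl | rfl | rfl)
  · exact apply_mem_iff_of_mul_self M.invol0 h0
  · exact apply_mem_iff_of_mul_self M.invol1 h1
  · exact apply_mem_iff_of_mul_self M.invol2 h2

section Automorphisms

variable {g : Equiv.Perm F}

theorem aut_s0 (hg : g ∈ M.aut) (x : F) : g (M.s0 x) = M.s0 (g x) := (mem_aut.1 hg).1 x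

theorem aut_s1 (hg : g ∈ M.aut) (x : F) : g (M.s1 x) = M.s1 (g x) := (mem_aut.1 hg).2.1 x

theorem aut_s2 (hg : g ∈ M.aut) (x : F) : g (M.s2 x) = M.s2 (g x) := (mem_aut.1 hg).2.2 x

theorem aut_rot (hg : g ∈ M.aut) (x : F) : g (M.rot x) = M.rot (g x) := by
  rw [rot_apply, aut_s1 hg, aut_s2 hg, rot_apply]

theorem aut_rot_iterate (hg : g ∈ M.aut) (n : ℕ) (x : F) : g (M.rot^[n] x) = M.rot^[n] (g x) :=
  ((show Function.Semiconj g M.rot M.rot from aut_rot hg).iterate_right n).eq x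

theorem eq_one_of_mem_aut (hg : g ∈ M.aut) {x : F} (hx : g x = x) : g = 1 := by
  refine Equiv.ext fun y => conn_induction (M := M) (P := fun y => g y = y) hx ?_ ?_ ?_ y
  · exact fun y hy => by rw [aut_s0 hg, hy]
  · exact fun y hy => by rw [aut_s1 hg, hy]
  · exact fun y hy => by rw [aut_s2 hg, hy]

theorem IsOrientation.aut_mem_iff {O : Set F} (hO : M.IsOrientation O) (hg : g ∈ M.aut) {x : F}
    (hx : g x ∈ O ↔ x ∈ O) (y : F) : g y ∈ O ↔ y ∈ O := by
  refine conn_induction (M := M) (P := fun y => g y ∈ O ↔ y ∈ O) hx ?_ ?_ ?_ y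
  · exact fun y hy => by rw [aut_s0 hg, hO.1, hO.1, hy]
  · exact fun y hy => by rw [aut_s1 hg, hO.2.1, hO.2.1, hy]
  · exact fun y hy => by rw [aut_s2 hg, hO.2.2, hO.2.2, hy]

end Automorphisms

section FlagOrbit

theorem flagOrbit_congr {f : F → F} (hf : ∀ g ∈ M.aut, ∀ x, g (f x) = f (g x)) {x y : F}
    (h : M.flagOrbit x = M.flagOrbit y) : M.flagOrbit (f x) = M.flagOrbit (f y) := by
  obtain ⟨g, hg, rfl⟩ := flagOrbit_eq_iff.1 h
  exact flagOrbit_eq_iff.2 ⟨g, hg, hf g hg y⟩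

theorem flagOrbit_apply (g : Equiv.Perm F) (hg : g ∈ M.aut) (x : F) :
    M.flagOrbit (g x) = M.flagOrbit x :=
  flagOrbit_eq_iff.2 ⟨g, hg, rfl⟩

end FlagOrbit

section Corner

variable (M) in
/-- The flag in position `l` at the vertex of `x`. -/
def corner (x : F) (l : Corner) : F :=
  bif l.2 then M.s2 (M.rot^[l.1] x) else M.rot^[l.1] x

theorem aut_corner {g : Equiv.Perm F} (hg : g ∈ M.aut) (x : F) (l : Corner) :
    g (M.corner x l) = M.corner (g x) l := by
  obtain ⟨i, _ | _⟩ := l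
  · exact aut_rot_iterate hg i x
  · change g (M.s2 (M.rot^[i] x)) = M.s2 (M.rot^[i] (g x))
    rw [aut_s2 hg, aut_rot_iterate hg]

theorem corner_s2 (x : F) (l : Corner) : M.corner x l.s2 = M.s2 (M.corner x l) := by
  obtain ⟨i, _ | _⟩ := l
  · rfl
  · exact (M.s2_s2 _).symm

section

variable (h7 : ∀ x, M.rot^[7] x = x)
include h7

theorem rot_iterate_add_one (x : F) (i : Fin 7) :
    M.rot^[(i + 1 : Fin 7)] x = M.rot (M.rot^[i] x) := by
  rw [← Function.iterate_succ_apply' M.rot]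
  revert i
  intro i
  fin_cases i
  all_goals first | rfl | exact (h7 x).symm

theorem corner_s1 (x : F) (l : Corner) : M.corner x l.s1 = M.s1 (M.corner x l) := by
  obtain ⟨i, _ | _⟩ := l
  · change M.s2 (M.rot^[(i - 1 : Fin 7)] x) = M.s1 (M.rot^[i] x)
    nth_rw 2 [← sub_add_cancel i 1]
    rw [rot_iterate_add_one h7, rot_apply, s1_s1]
  · exact rot_iterate_add_one h7 x i

theorem mem_vertexOf_iff {x y : F} : y ∈ M.vertexOf x ↔ ∃ l, y = M.corner x l := by
  constructor
  · rintro ⟨⟨k, hk⟩, rfl⟩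
    refine (apply_mem_iff_of_mem_closure (T := {y | ∃ l, y = M.corner x l}) ?_ hk x).2
      ⟨(0, false), rfl⟩
    rintro s (rfl | rfl)
    · refine apply_mem_iff_of_mul_self M.invol1 ?_
      rintro _ ⟨l, rfl⟩
      exact ⟨l.s1, (corner_s1 h7 x l).symm⟩
    · refine apply_mem_iff_of_mul_self M.invol2 ?_
      rintro _ ⟨l, rfl⟩
      exact ⟨l.s2, (corner_s2 x l).symm⟩
  · rintro ⟨⟨i, _ | _⟩, rfl⟩
    · exact rot_iterate_mem_vertexOf i x
    · exact s2_rot_iterate_mem_vertexOf i x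

theorem corner_mem_vertexOf (x : F) (l : Corner) : M.corner x l ∈ M.vertexOf x :=
  (mem_vertexOf_iff h7).2 ⟨l, rfl⟩

theorem corner_injective (hE : M.Equivelar 3 7) (x : F) : Function.Injective (M.corner x) := by
  have hf : Function.Surjective
      fun l => (⟨M.corner x l, corner_mem_vertexOf h7 x l⟩ : M.vertexOf x) := by
    rintro ⟨y, hy⟩
    obtain ⟨l, rfl⟩ := (mem_vertexOf_iff h7).1 hy
    exact ⟨l, rfl⟩
  have := (Nat.bijective_iff_surjective_and_card _).2 ⟨hf, by rw [hE.2 x]; simp⟩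
  exact fun l l' hl => this.1 (Subtype.ext hl)

theorem aut_mem_vertexOf {g : Equiv.Perm F} (hg : g ∈ M.aut) {x y : F} (h : x ∈ M.vertexOf y) :
    g x ∈ M.vertexOf (g y) := by
  obtain ⟨l, rfl⟩ := (mem_vertexOf_iff h7).1 h
  rw [aut_corner hg]
  exact corner_mem_vertexOf h7 _ l

end

end Corner

/-- In a vertex-transitive map in which a rotation by one step is induced by an automorphism,
every flag is equivalent to a given one or to its neighbour across an edge. -/
theorem flagOrbit_eq_or_eq (h7 : ∀ x, M.rot^[7] x = x) (hT : M.VertexTransitive) {x : F}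
    (hx : M.flagOrbit (M.rot x) = M.flagOrbit x) (y : F) :
    M.flagOrbit y = M.flagOrbit x ∨ M.flagOrbit y = M.flagOrbit (M.s2 x) := by
  have hi : ∀ n : ℕ, M.flagOrbit (M.rot^[n] x) = M.flagOrbit x := by
    intro n
    induction n with
    | zero => rfl
    | succ n ih =>
      rw [Function.iterate_succ_apply', flagOrbit_congr (fun g hg => aut_rot hg) ih, hx]
  obtain ⟨g, hg, hgy⟩ := hT x y
  obtain ⟨l, rfl⟩ := (mem_vertexOf_iff h7).1 (vertexOf_eq_iff.1 hgy.symm)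
  rw [← aut_corner hg, flagOrbit_apply g hg]
  obtain ⟨i, _ | _⟩ := l
  · exact Or.inl (hi i)
  · exact Or.inr (flagOrbit_congr (fun g hg => aut_s2 hg) (hi i))

theorem flagOrbit_rot_ne (h7 : ∀ x, M.rot^[7] x = x)
    (h3 : ∀ x, M.s0 (M.s1 (M.s0 (M.s1 (M.s0 (M.s1 x))))) = x) (hT : M.VertexTransitive)
    (hR : ¬ M.IsRegular) (hC : ¬ M.IsChiral) (x : F) :
    M.flagOrbit (M.rot x) ≠ M.flagOrbit x := by
  intro hx
  have c0 {y z : F} : M.flagOrbit y = M.flagOrbit z → M.flagOrbit (M.s0 y) = M.flagOrbit (M.s0 z) :=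
    flagOrbit_congr fun g hg => aut_s0 hg
  have c1 {y z : F} : M.flagOrbit y = M.flagOrbit z → M.flagOrbit (M.s1 y) = M.flagOrbit (M.s1 z) :=
    flagOrbit_congr fun g hg => aut_s1 hg
  have c2 {y z : F} : M.flagOrbit y = M.flagOrbit z → M.flagOrbit (M.s2 y) = M.flagOrbit (M.s2 z) :=
    flagOrbit_congr fun g hg => aut_s2 hg
  have hor := flagOrbit_eq_or_eq h7 hT hx
  have hrange : Set.range M.flagOrbit = {M.flagOrbit x, M.flagOrbit (M.s2 x)} := by
    ext t
    constructor
    · rintro ⟨y, rfl⟩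
      exact hor y
    · rintro (rfl | rfl) <;> exact ⟨_, rfl⟩
  have h12 : M.flagOrbit (M.s1 x) = M.flagOrbit (M.s2 x) := by
    have := c1 hx
    rw [rot_apply, s1_s1] at this
    exact this.symm
  by_cases hs : M.flagOrbit (M.s2 x) = M.flagOrbit x
  · refine hR ?_
    rw [IsRegular, IsKOrbit, numFlagOrbits, hrange, hs]
    simp
  have hs2 (y : F) : M.flagOrbit (M.s2 y) ≠ M.flagOrbit y := by
    rcases hor y with hy | hy <;> rw [hy, c2 hy]
    · exact hs
    · rw [s2_s2]
      exact Ne.symm hs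
  have hs1 (y : F) : M.flagOrbit (M.s1 y) = M.flagOrbit (M.s2 y) := by
    rcases hor y with hy | hy <;> rw [c1 hy, c2 hy]
    · exact h12
    · rw [← rot_apply, s2_s2, hx]
  refine hC ⟨?_, fun y => ⟨fun hy => ?_, fun hy => hs2 y ?_, fun hy => hs2 y ?_⟩⟩
  · rw [IsKOrbit, numFlagOrbits, hrange, Nat.card_coe_set_eq, Set.ncard_pair (Ne.symm hs)]
  · have h0 : M.flagOrbit (M.s0 x) = M.flagOrbit x := by
      have hy' : M.flagOrbit (M.s0 y) = M.flagOrbit y := MulAction.orbit_eq_iff.2 hy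
      rcases hor y with h | h
      · rw [← h, ← c0 h, hy']
      · have := c2 ((c0 h).symm.trans (hy'.trans h))
        rwa [s0_s2, s2_s2, s2_s2] at this
    have h01 : M.flagOrbit (M.s0 (M.s1 x)) = M.flagOrbit (M.s2 x) := by
      rw [c0 h12, s0_s2, c2 h0]
    have h21 : M.flagOrbit (M.s1 (M.s2 x)) = M.flagOrbit x := hx
    have h02 : M.flagOrbit (M.s0 (M.s1 (M.s0 (M.s1 x)))) = M.flagOrbit x := by
      rw [c0 (c1 h01), c0 h21, h0]
    have := c0 (c1 h02)
    rw [h3, h01] at this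
    exact hs this.symm
  · rw [← hs1]
    exact MulAction.orbit_eq_iff.2 hy
  · exact MulAction.orbit_eq_iff.2 hy

theorem flagOrbit_rot_iterate_ne (h7 : ∀ x, M.rot^[7] x = x)
    (hx : ∀ x, M.flagOrbit (M.rot x) ≠ M.flagOrbit x) {i : Fin 7} (hi : i ≠ 0) (x : F) :
    M.flagOrbit (M.rot^[i] x) ≠ M.flagOrbit x := by
  intro h
  have hk : ∀ k : ℕ, M.flagOrbit (M.rot^[i * k] x) = M.flagOrbit x := by
    intro k
    rw [Function.iterate_mul]
    induction k with
    | zero => rfl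
    | succ k ih =>
      rw [Function.iterate_succ_apply', flagOrbit_congr (fun g hg => aut_rot_iterate hg i) ih, h]
  obtain ⟨k, m, hkm⟩ : ∃ k m, (i : ℕ) * k = 1 + 7 * m := by
    have : ∀ i : Fin 7, i ≠ 0 → ∃ k m : Fin 7, (i : ℕ) * k = 1 + 7 * m := by decide
    obtain ⟨k, m, h⟩ := this i hi
    exact ⟨k, m, h⟩
  refine hx x ?_
  have := hk k
  rwa [hkm, Function.iterate_add_apply, Function.iterate_mul,
    show M.rot^[7] = id from funext h7, Function.iterate_id] at this

end CMap

namespace CMap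

variable {F : Type} [Fintype F] {M : CMap F} {O : Set F}

theorem mem_vertexOf_trans {x y z : F} (h : x ∈ M.vertexOf y) (h' : y ∈ M.vertexOf z) :
    x ∈ M.vertexOf z :=
  vertexOf_eq_iff.1 ((vertexOf_eq_iff.2 h).trans (vertexOf_eq_iff.2 h'))

theorem IsOrientation.corner_mem_iff (hO : M.IsOrientation O) (x : F) (l : Corner) :
    M.corner x l ∈ O ↔ (bif l.2 then x ∉ O else x ∈ O) := by
  have hr : ∀ n : ℕ, M.rot^[n] x ∈ O ↔ x ∈ O := by
    intro n
    induction n with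
    | zero => rfl
    | succ n ih => rw [Function.iterate_succ_apply', rot_apply, hO.2.1, hO.2.2, not_not, ih]
  obtain ⟨i, _ | _⟩ := l
  · exact hr i
  · exact (hO.2.2 _).trans (not_congr (hr i))

/-- An orientable map as in the theorem has a group of automorphisms which is regular on the
vertices. -/
theorem exists_regular_subgroup (hO : M.IsOrientation O) (h7 : ∀ x, M.rot^[7] x = x)
    (hT : M.VertexTransitive) (hrot : ∀ x, M.flagOrbit (M.rot x) ≠ M.flagOrbit x) :
    ∃ A ≤ M.aut, (∀ x y, ∃ g ∈ A, g x ∈ M.vertexOf y) ∧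
      ∀ g ∈ A, ∀ x, g x ∈ M.vertexOf x → g = 1 := by
  have hfix : ∀ g ∈ M.aut, ∀ x (l : Corner), l.2 = false → g x = M.corner x l → g = 1 := by
    rintro g hg x ⟨i, _⟩ rfl hgx
    have hi : i = 0 := by
      by_contra hi
      refine flagOrbit_rot_iterate_ne h7 hrot hi x ?_
      exact flagOrbit_eq_iff.2 ⟨g, hg, hgx⟩
    subst hi
    exact eq_one_of_mem_aut hg hgx
  have hT' : ∀ x y, ∃ g ∈ M.aut, g x ∈ M.vertexOf y := fun x y => by
    obtain ⟨g, hg, h⟩ := hT x y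
    exact ⟨g, hg, vertexOf_eq_iff.1 h⟩
  by_cases href : ∃ g ∈ M.aut, ∃ x, ∃ l : Corner, l.2 = true ∧ g x = M.corner x l
  · obtain ⟨r, hr, z, l, hl, hrz⟩ := href
    have hrO : ¬ (r z ∈ O ↔ z ∈ O) := by
      rw [hrz, hO.corner_mem_iff, hl]
      simp
    refine ⟨M.aut ⊓ { carrier := {g | ∀ y, g y ∈ O ↔ y ∈ O},
                      mul_mem' := fun {a b} ha hb y => (ha _).trans (hb y),
                      one_mem' := fun y => Iff.rfl,
                      inv_mem' := fun {a} ha y => by simpa using (ha (a⁻¹ y)).symm },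
      inf_le_left, fun x y => ?_, fun g ⟨hg, hgO⟩ x hx => ?_⟩
    · obtain ⟨g, hg, hgx⟩ := hT' x z
      obtain ⟨k, hk, hkz⟩ := hT' z y
      by_cases hkg : k (g x) ∈ O ↔ x ∈ O
      · have hm : k * g ∈ M.aut := mul_mem hk hg
        exact ⟨k * g, ⟨hm, hO.aut_mem_iff hm hkg⟩,
          mem_vertexOf_trans (aut_mem_vertexOf h7 hk hgx) hkz⟩
      · have hm : k * r * g ∈ M.aut := mul_mem (mul_mem hk hr) hg
        refine ⟨k * r * g, ⟨hm, hO.aut_mem_iff hm (x := x) ?_⟩,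
          mem_vertexOf_trans (aut_mem_vertexOf h7 hk (mem_vertexOf_trans
            (aut_mem_vertexOf h7 hr hgx) (hrz ▸ corner_mem_vertexOf h7 z l))) hkz⟩
        have h1 : r (g x) ∈ O ↔ g x ∉ O := by
          have := mt (fun h => hO.aut_mem_iff hr (x := g x) h z) hrO
          tauto
        by_cases hk1 : k (g x) ∈ O ↔ g x ∈ O
        · have := hO.aut_mem_iff hk hk1 (r (g x))
          change k (r (g x)) ∈ O ↔ _
          tauto
        · have := mt (fun h => hO.aut_mem_iff hk (x := r (g x)) h (g x)) hk1
          change k (r (g x)) ∈ O ↔ _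
          tauto
    · obtain ⟨l, hl⟩ := (mem_vertexOf_iff h7).1 hx
      refine hfix g hg x l (Bool.eq_false_iff.2 fun hl2 => ?_) hl
      have := hgO x
      rw [hl, hO.corner_mem_iff, hl2] at this
      exact absurd this (by simp)
  · refine ⟨M.aut, le_rfl, hT', fun g hg x hx => ?_⟩
    obtain ⟨l, hl⟩ := (mem_vertexOf_iff h7).1 hx
    exact hfix g hg x l (Bool.eq_false_iff.2 fun hl2 => href ⟨g, hg, x, l, hl2, hl⟩) hl

/-- The bijection `e` identifies `M` with the map given by a voltage pairing. -/
structure IsDerived {G : Type} [Group G] (M : CMap F) (D : VoltagePairing G)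
    (e : F ≃ G × Corner) : Prop where
  s0 : ∀ x, e (M.s0 x) = D.s0 (e x)
  s1 : ∀ x, e (M.s1 x) = VoltagePairing.s1 (e x)
  s2 : ∀ x, e (M.s2 x) = VoltagePairing.s2 (e x)

theorem exists_isDerived (hE : M.Equivelar 3 7) (h7 : ∀ x, M.rot^[7] x = x)
    {A : Subgroup (Equiv.Perm F)} (hA : A ≤ M.aut)
    (htrans : ∀ x y, ∃ g ∈ A, g x ∈ M.vertexOf y)
    (hfree : ∀ g ∈ A, ∀ x, g x ∈ M.vertexOf x → g = 1) :
    ∃ (D : VoltagePairing A) (e : F ≃ A × Corner), M.IsDerived D e := by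
  obtain ⟨x⟩ := M.nonempty
  have hf : Function.Bijective fun p : A × Corner => (p.1 : Equiv.Perm F) (M.corner x p.2) := by
    constructor
    · rintro ⟨g, l⟩ ⟨g', l'⟩ h
      change g.1 (M.corner x l) = g'.1 (M.corner x l') at h
      have h1 : (g'⁻¹ * g).1 = 1 := by
        refine hfree _ (g'⁻¹ * g).2 (M.corner x l) ?_
        have : (g'⁻¹ * g).1 (M.corner x l) = M.corner x l' := by
          change g'.1⁻¹ (g.1 (M.corner x l)) = _
          rw [h]
          exact g'.1.symm_apply_apply _
        rw [this]
        exact mem_vertexOf_trans (corner_mem_vertexOf h7 x l')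
          (MulAction.mem_orbit_symm.1 (corner_mem_vertexOf h7 x l))
      obtain rfl : g = g' := by
        rw [← inv_mul_eq_one.1 (Subtype.ext h1)]
      rw [corner_injective h7 hE x (g.1.injective h)]
    · intro y
      obtain ⟨g, hg, hgy⟩ := htrans y x
      obtain ⟨l, hl⟩ := (mem_vertexOf_iff h7).1 hgy
      exact ⟨⟨⟨g, hg⟩⁻¹, l⟩, by
        change g⁻¹ (M.corner x l) = y
        rw [← hl]
        exact g.symm_apply_apply y⟩
  let e := (Equiv.ofBijective _ hf).symm
  have he (g : A) (l : Corner) : e.symm (g, l) = g.1 (M.corner x l) := rfl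
  have hs0 (l : Corner) : (e (M.s0 (M.corner x l))).1.1
      (M.corner x (e (M.s0 (M.corner x l))).2) = M.s0 (M.corner x l) := by
    rw [← he, Prod.mk.eta, e.symm_apply_apply]
  refine ⟨{ pair := fun i => (e (M.s0 (M.corner x (i, false)))).2.1
            flip := fun i => (e (M.s0 (M.corner x (i, false)))).2.2
            volt := fun i => (e (M.s0 (M.corner x (i, false)))).1 }, e, ?_, ?_, ?_⟩
  · intro y
    obtain ⟨⟨g, i, b⟩, rfl⟩ := e.symm.surjective y
    rw [e.apply_symm_apply, ← e.eq_symm_apply, he, ← aut_s0 (hA g.2)]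
    simp only [VoltagePairing.s0, DartPairing.s0, he]
    change _ = g.1 ((e (M.s0 (M.corner x (i, false)))).1.1 _)
    congr 1
    cases b
    · rw [Bool.false_xor, hs0]
    · rw [Bool.true_xor]
      change M.s0 (M.corner x (Corner.s2 (i, false))) = (e (M.s0 (M.corner x (i, false)))).1.1
        (M.corner x (Corner.s2 (e (M.s0 (M.corner x (i, false)))).2))
      rw [corner_s2, s0_s2, corner_s2, aut_s2 (hA (Subtype.prop _)), hs0]
  · intro y
    obtain ⟨⟨g, l⟩, rfl⟩ := e.symm.surjective y
    rw [e.apply_symm_apply, ← e.eq_symm_apply, he, ← aut_s1 (hA g.2), ← corner_s1 h7]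
    rfl
  · intro y
    obtain ⟨⟨g, l⟩, rfl⟩ := e.symm.surjective y
    rw [e.apply_symm_apply, ← e.eq_symm_apply, he, ← aut_s2 (hA g.2), ← corner_s2]
    rfl

end CMap

namespace DartPairing

/-- The pairing describes the triangles of a closed surface. -/
structure IsTriangular (P : DartPairing) : Prop where
  s0_s0 : ∀ l, P.s0 (P.s0 l) = l
  face : ∀ l, P.s0 (P.s0 (P.s0 l.s1).s1).s1 = l

/-- Renumbering of the darts at a vertex, from a new first corner. -/
def turn (l : Corner) : Equiv.Perm (Fin 7) where
  toFun i := bif l.2 then l.1 - i else i + l.1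
  invFun i := bif l.2 then l.1 - i else i - l.1
  left_inv := by revert l; decide
  right_inv := by revert l; decide

/-- Renumbering of the corners at a vertex, from a new first corner. -/
def turnCorner (l : Corner) : Equiv.Perm Corner :=
  (turn l).prodCongr ⟨fun b => Bool.xor b l.2, fun b => Bool.xor b l.2,
    by simp [Function.LeftInverse],
    by simp [Function.RightInverse, Function.LeftInverse]⟩

theorem turnCorner_s1 : ∀ l m : Corner, turnCorner l m.s1 = (turnCorner l m).s1 := by decide

theorem turnCorner_s2 : ∀ l m : Corner, turnCorner l m.s2 = (turnCorner l m).s2 := by decide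

theorem turnCorner_zero : ∀ l : Corner, turnCorner l (0, false) = l := by decide

def rebase (P : DartPairing) (l : Corner) : DartPairing where
  pair i := (turn l).symm (P.pair (turn l i))
  flip i := P.flip (turn l i)

theorem turnCorner_rebase_s0 (P : DartPairing) (l m : Corner) :
    turnCorner l ((P.rebase l).s0 m) = P.s0 (turnCorner l m) := by
  simp only [turnCorner, rebase, s0, Equiv.prodCongr_apply, Prod.map, Equiv.coe_fn_mk,
    Equiv.apply_symm_apply, Bool.xor_right_comm]

def ofCorners (p : Fin 7 → Corner) : DartPairing := ⟨fun i => (p i).1, fun i => (p i).2⟩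

def Compatible (i j : Fin 7) (p q : Corner) : Prop :=
  (p.1 = j ↔ q.1 = i) ∧ (p.1 = j → p.2 = q.2)

instance (i j : Fin 7) (p q : Corner) : Decidable (Compatible i j p q) :=
  inferInstanceAs (Decidable (_ ∧ _))

def IsNormal (P : DartPairing) : Prop :=
  (P.pair = ![0, 2, 1, 6, 5, 4, 3] ∧ P.flip = ![true, true, true, true, false, false, true]) ∨
  (P.pair = ![0, 3, 6, 1, 5, 4, 2] ∧ P.flip = ![true, false, false, false, true, true, false]) ∨
  (P.pair = ![0, 1, 6, 3, 5, 4, 2] ∧ P.flip = fun _ => true)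

instance (P : DartPairing) : Decidable P.IsNormal :=
  inferInstanceAs (Decidable (_ ∨ _))

set_option synthInstance.maxHeartbeats 400000 in
set_option synthInstance.maxSize 2000 in
set_option maxRecDepth 100000 in
theorem exists_isNormal_aux : ∀ p₁, Compatible 0 1 (6, true) p₁ → Compatible 1 6 p₁ (0, true) →
    ∀ p₂, Compatible 0 2 (6, true) p₂ → Compatible 2 6 p₂ (0, true) → Compatible 1 2 p₁ p₂ →
    ∀ p₃, Compatible 0 3 (6, true) p₃ → Compatible 3 6 p₃ (0, true) → Compatible 1 3 p₁ p₃ →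
      Compatible 2 3 p₂ p₃ →
    ∀ p₄, Compatible 0 4 (6, true) p₄ → Compatible 4 6 p₄ (0, true) → Compatible 1 4 p₁ p₄ →
      Compatible 2 4 p₂ p₄ → Compatible 3 4 p₃ p₄ →
    ∀ p₅, Compatible 0 5 (6, true) p₅ → Compatible 5 6 p₅ (0, true) → Compatible 1 5 p₁ p₅ →
      Compatible 2 5 p₂ p₅ → Compatible 3 5 p₃ p₅ → Compatible 4 5 p₄ p₅ →
    (∀ l, (fun l => (ofCorners ![(6, true), p₁, p₂, p₃, p₄, p₅, (0, true)]).s0 l.s1)^[3] l = l) →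
    ∃ l, ((ofCorners ![(6, true), p₁, p₂, p₃, p₄, p₅, (0, true)]).rebase l).IsNormal := by
  decide +kernel

namespace IsTriangular

variable {P : DartPairing} (h : P.IsTriangular)
include h

theorem rebase (l : Corner) : (P.rebase l).IsTriangular where
  s0_s0 m := (turnCorner l).injective (by
    rw [turnCorner_rebase_s0, turnCorner_rebase_s0, h.s0_s0])
  face m := (turnCorner l).injective (by
    rw [turnCorner_rebase_s0, turnCorner_s1, turnCorner_rebase_s0, turnCorner_s1,
      turnCorner_rebase_s0, turnCorner_s1, h.face])

theorem compatible (i j : Fin 7) :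
    Compatible i j (P.s0 (i, false)) (P.s0 (j, false)) := by
  have hs (i : Fin 7) (b : Bool) : P.s0 (i, b) = (P.pair i, Bool.xor b (P.flip i)) := rfl
  have hi := h.s0_s0 (i, false)
  have hj := h.s0_s0 (j, false)
  simp only [hs, Prod.mk.injEq, Bool.false_xor, bne_eq_false_iff_eq] at hi hj
  refine ⟨⟨?_, ?_⟩, ?_⟩
  · rintro rfl
    exact hi.1
  · rintro rfl
    exact hj.1
  · rintro rfl
    simp only [hs, Bool.false_xor]
    exact hi.2

theorem exists_s0_s1_eq : ∃ l : Corner, P.s0 l.s1 = l := by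
  let f : Function.End Corner := fun l => P.s0 l.s1
  have hf : f ^ 3 ^ 1 = 1 := funext h.face
  have hc := Equiv.Perm.card_fixedPoints_modEq hf
  by_contra! hne
  have : IsEmpty (Function.fixedPoints f) := ⟨fun l => hne l l.2⟩
  simp [Nat.ModEq] at hc

theorem exists_isNormal : ∃ l m, ((P.rebase l).rebase m).IsNormal := by
  obtain ⟨l, hl⟩ := h.exists_s0_s1_eq
  have h' := h.rebase l
  have hl' : (P.rebase l).s0 (Corner.s1 (0, false)) = (0, false) := (turnCorner l).injective (by
    rw [turnCorner_rebase_s0, turnCorner_s1, turnCorner_zero, hl])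
  refine ⟨l, ?_⟩
  generalize P.rebase l = Q at h' hl'
  have h0 := h'.s0_s0 (6, true)
  have h6 : Q.s0 (6, true) = (0, false) := hl'
  rw [h6] at h0
  have h6' : Q.s0 (6, false) = (0, true) := by
    simp only [DartPairing.s0, Prod.mk.injEq] at h6 ⊢
    simpa using h6
  have hQ : Q = ofCorners ![(6, true), Q.s0 (1, false), Q.s0 (2, false), Q.s0 (3, false),
      Q.s0 (4, false), Q.s0 (5, false), (0, true)] := by
    rw [← h0, ← h6']
    obtain ⟨τ, ε⟩ := Q
    have : ∀ i, ![0, 1, 2, 3, 4, 5, 6] i = (i : Fin 7) := by decide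
    simp only [ofCorners, DartPairing.s0, DartPairing.mk.injEq, Bool.false_xor]
    constructor <;> funext i <;> fin_cases i <;> rfl
  have c := h'.compatible
  have f := h'.face
  rw [hQ]
  refine exists_isNormal_aux _ ?_ ?_ _ ?_ ?_ (c 1 2) _ ?_ ?_ (c 1 3) (c 2 3) _ ?_ ?_ (c 1 4) (c 2 4)
    (c 3 4) _ ?_ ?_ (c 1 5) (c 2 5) (c 3 5) (c 4 5) (fun l => ?_)
  any_goals first | (rw [← h0]; exact c _ _) | (rw [← h6']; exact c _ _)
  rw [← hQ]
  exact f l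

end IsTriangular

end DartPairing

/-- The voltages describe a triangulated orientable surface with twelve vertices. -/
structure VoltagePairing.IsTriangulation {G : Type} [Group G] (D : VoltagePairing G) : Prop where
  s0_s0 : ∀ z, D.s0 (D.s0 z) = z
  face : ∀ z, D.s0 (s1 (D.s0 (s1 (D.s0 (s1 z))))) = z
  face_ne : ∀ z, D.s0 (s1 z) ≠ z
  card : Nat.card G = 12
  induction : ∀ P : G → Prop, P 1 → (∀ g i, P g → P (g * D.volt i)) → ∀ g, P g
  orient : ∃ κ : G → Prop, ∀ g i, κ (g * D.volt i) ↔ (bif D.flip i then κ g else ¬ κ g)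

theorem VoltagePairing.IsTriangulation.isTriangular {G : Type} [Group G] {D : VoltagePairing G}
    (h : D.IsTriangulation) : D.toDartPairing.IsTriangular where
  s0_s0 l := congrArg Prod.snd (h.s0_s0 (1, l))
  face l := congrArg Prod.snd (h.face (1, l))

def VoltagePairing.rebase {G : Type} (D : VoltagePairing G) (l : Corner) : VoltagePairing G where
  toDartPairing := D.toDartPairing.rebase l
  volt i := D.volt (DartPairing.turn l i)

namespace CMap.IsDerived

open VoltagePairing

variable {F G : Type} [Fintype F] [Group G] {M : CMap F} {D : VoltagePairing G}
  {e : F ≃ G × Corner} (h : M.IsDerived D e)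
include h

theorem rebase (l : Corner) : M.IsDerived (D.rebase l)
    (e.trans ((Equiv.refl G).prodCongr (DartPairing.turnCorner l).symm)) := by
  refine ⟨fun x => ?_, fun x => ?_, fun x => ?_⟩
  · rw [Equiv.trans_apply, Equiv.trans_apply, h.s0]
    obtain ⟨⟨g, m⟩, hx⟩ := ((Equiv.refl G).prodCongr (DartPairing.turnCorner l)).surjective (e x)
    rw [← hx]
    refine Prod.ext ?_ ((Equiv.symm_apply_eq _).2 ?_)
    · simp [VoltagePairing.s0, VoltagePairing.rebase, DartPairing.turnCorner]
    · exact ((DartPairing.turnCorner_rebase_s0 D.toDartPairing l _).trans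
        (by simp)).symm
  · rw [Equiv.trans_apply, Equiv.trans_apply, h.s1]
    refine Prod.ext rfl ((Equiv.symm_apply_eq _).2 ?_)
    exact ((DartPairing.turnCorner_s1 l _).trans (by simp)).symm
  · rw [Equiv.trans_apply, Equiv.trans_apply, h.s2]
    refine Prod.ext rfl ((Equiv.symm_apply_eq _).2 ?_)
    exact ((DartPairing.turnCorner_s2 l _).trans (by simp)).symm

theorem isTriangulation {O : Set F} (hO : M.IsOrientation O)
    (h3 : ∀ x, M.s0 (M.s1 (M.s0 (M.s1 (M.s0 (M.s1 x))))) = x)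
    (hne : ∀ x, M.s0 (M.s1 x) ≠ x) (hcard : Nat.card F = 168) : D.IsTriangulation where
  s0_s0 z := by
    obtain ⟨x, rfl⟩ := e.surjective z
    rw [← h.s0, ← h.s0, M.s0_s0]
  face z := by
    obtain ⟨x, rfl⟩ := e.surjective z
    rw [← h.s1, ← h.s0, ← h.s1, ← h.s0, ← h.s1, ← h.s0, h3]
  face_ne z := by
    obtain ⟨x, rfl⟩ := e.surjective z
    rw [← h.s1, ← h.s0, e.apply_eq_iff_eq.ne]
    exact hne x
  card := by
    rw [Nat.card_congr e, Nat.card_prod] at hcard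
    simp at hcard
    lia
  induction P h1 hP g := by
    have key := conn_induction (M := M) (P := fun y => P (e y).1) (x := e.symm (1, 0, false))
      (by simpa using h1) (fun y hy => by rw [h.s0]; exact hP _ _ hy)
      (fun y hy => by rwa [h.s1]) (fun y hy => by rwa [h.s2]) (e.symm (g, 0, false))
    simpa using key
  orient := by
    have hs0 (z : G × Corner) : e.symm (D.s0 z) = M.s0 (e.symm z) := by
      rw [e.symm_apply_eq, h.s0, e.apply_symm_apply]
    have hs1 (z : G × Corner) : e.symm (VoltagePairing.s1 z) = M.s1 (e.symm z) := by
      rw [e.symm_apply_eq, h.s1, e.apply_symm_apply]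
    have hs2 (z : G × Corner) : e.symm (VoltagePairing.s2 z) = M.s2 (e.symm z) := by
      rw [e.symm_apply_eq, h.s2, e.apply_symm_apply]
    have hfalse (g : G) (i : Fin 7) : e.symm (g, i, false) ∈ O ↔ e.symm (g, 0, false) ∈ O := by
      induction i using Fin.induction with
      | zero => rfl
      | succ i ih =>
        rw [← ih, ← Fin.coeSucc_eq_succ, ← not_not (a := e.symm (g, i.castSucc, false) ∈ O),
          ← hO.2.2, ← hO.2.1, ← hs2, ← hs1]
        rfl
    have htrue (g : G) (i : Fin 7) : e.symm (g, i, true) ∈ O ↔ e.symm (g, 0, false) ∉ O := by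
      rw [← hfalse g i, ← hO.2.2, ← hs2]
      rfl
    refine ⟨fun g => e.symm (g, 0, false) ∈ O, fun g i => ?_⟩
    have key := hO.1 (e.symm (g, i, false))
    rw [← hs0, hfalse, VoltagePairing.s0, DartPairing.s0] at key
    cases hi : D.flip i
    · rw [hi] at key
      exact (hfalse _ _).symm.trans key
    · rw [hi] at key
      exact not_iff_not.1 ((htrue _ _).symm.trans key)

theorem isomorphic {G₀ F₀ : Type} [Group G₀] [Fintype F₀] (hD : D.IsTriangulation)
    {D₀ : VoltagePairing G₀} (h₀ : D₀.IsAdmissible) (e₀ : F₀ ≃ G₀ × Corner)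
    (hcard : Nat.card F₀ = 168) (hpair : D.toDartPairing = D₀.toDartPairing) (φ : G₀ →* G)
    (hφ : ∀ i, φ (D₀.volt i) = D.volt i) : M.Isomorphic (toMap h₀ e₀) := by
  have hsurj : Function.Surjective φ := hD.induction _ ⟨1, map_one φ⟩ fun g i ⟨a, ha⟩ =>
    ⟨a * D₀.volt i, by rw [map_mul, ha, hφ]⟩
  have hcard₀ : Nat.card G₀ = 12 := by
    rw [Nat.card_congr e₀, Nat.card_prod] at hcard
    simp at hcard
    lia
  have : Finite G := Nat.finite_of_card_ne_zero (by simp [hD.card])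
  have : Finite G₀ := Nat.finite_of_card_ne_zero (by simp [hcard₀])
  let ψ := MulEquiv.ofBijective φ
    ((Nat.bijective_iff_surjective_and_card _).2 ⟨hsurj, by rw [hcard₀, hD.card]⟩)
  have hψ (i : Fin 7) : ψ (D₀.volt i) = D.volt i := hφ i
  refine ⟨(e.trans (ψ.symm.toEquiv.prodCongr (Equiv.refl Corner))).trans e₀.symm,
    fun x => e₀.injective ?_, fun x => e₀.injective ?_, fun x => e₀.injective ?_⟩
  · rw [apply_toMap_s0]
    simp [h.s0, VoltagePairing.s0, hpair, ← hψ]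
  · rw [apply_toMap_s1]
    simp [h.s1, VoltagePairing.s1]
  · rw [apply_toMap_s2]
    simp [h.s2, VoltagePairing.s2]

end CMap.IsDerived

section GroupsOfOrderTwelve

variable {G : Type} [Group G] {t : G}

theorem card_zpowers_eq_three (ht : t ^ 3 = 1) (ht1 : t ≠ 1) :
    Nat.card (Subgroup.zpowers t) = 3 := by
  have : Fact (Nat.Prime 3) := ⟨Nat.prime_three⟩
  rw [Nat.card_zpowers, orderOf_eq_prime ht ht1]

theorem eq_of_mem_zpowers_of_pow_three (ht : t ^ 3 = 1) {u : G} (hu : u ∈ Subgroup.zpowers t) :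
    u = 1 ∨ u = t ∨ u = t⁻¹ := by
  have hfin : IsOfFinOrder t := isOfFinOrder_iff_pow_eq_one.2 ⟨3, by norm_num, ht⟩
  obtain ⟨n, rfl⟩ := hfin.mem_powers_iff_mem_zpowers.2 hu
  change t ^ n = 1 ∨ t ^ n = t ∨ t ^ n = t⁻¹
  rw [pow_eq_pow_mod n ht]
  have : n % 3 < 3 := Nat.mod_lt _ (by norm_num)
  interval_cases n % 3
  · simp
  · simp
  · exact Or.inr (Or.inr (eq_inv_of_mul_eq_one_left (by rw [← pow_succ, ht])))

theorem conj_eq_or_of_zpowers_normal (ht : t ^ 3 = 1) (ht1 : t ≠ 1)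
    (hn : ∀ g : G, g * t * g⁻¹ ∈ Subgroup.zpowers t) (g : G) :
    g * t * g⁻¹ = t ∨ g * t * g⁻¹ = t⁻¹ :=
  (eq_of_mem_zpowers_of_pow_three ht (hn g)).resolve_left fun h =>
    ht1 (by rwa [conj_eq_one_iff] at h)

/-- In a group of order twelve with a subgroup of index two, the subgroup of order three is
unique. -/
theorem mem_zpowers_of_index_eq_two (hG : Nat.card G = 12) {H : Subgroup G} (hH : H.index = 2)
    (ht : t ^ 3 = 1) (ht1 : t ≠ 1) {g : G} (hg : g ^ 3 = 1) : g ∈ Subgroup.zpowers t := by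
  have sq (g : G) (hg : g ^ 3 = 1) : g = (g ^ 2) ^ 2 := by
    rw [← pow_mul, pow_succ g 3, hg, one_mul]
  have mem (g : G) (hg : g ^ 3 = 1) : g ∈ H := by
    rw [sq g hg]
    exact Subgroup.sq_mem_of_index_two hH _
  have hcard := H.card_mul_index
  rw [hG, hH] at hcard
  have hK : Nat.card ((Subgroup.zpowers t).subgroupOf H) = 3 := by
    rw [Nat.card_congr (Subgroup.subgroupOfEquivOfLe (Subgroup.zpowers_le.2 (mem t ht))).toEquiv,
      card_zpowers_eq_three ht ht1]
  have hidx := ((Subgroup.zpowers t).subgroupOf H).card_mul_index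
  rw [hK] at hidx
  have key := Subgroup.sq_mem_of_index_two (H := (Subgroup.zpowers t).subgroupOf H)
    (by lia) (⟨g, mem g hg⟩ ^ 2)
  rw [sq g hg]
  exact key

theorem eq_pow_six_of_index_eq_two (hG : Nat.card G = 12) {H : Subgroup G} (hH : H.index = 2)
    {c x : G} (hx : x * x = 1) (ht : (c ^ 2 * x) ^ 3 = 1) (ht1 : c ^ 2 * x ≠ 1) :
    c ^ 12 = 1 ∧ x = c ^ 6 := by
  have hconj := conj_eq_or_of_zpowers_normal ht ht1 (fun g => mem_zpowers_of_index_eq_two hG hH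
    ht ht1 (by rw [conj_pow, ht, mul_one, mul_inv_cancel])) c
  generalize htdef : c ^ 2 * x = t at *
  have hcomm : c ^ 2 * t = t * c ^ 2 := by
    have h2 : c * (c * t * c⁻¹) * c⁻¹ = t := by
      rcases hconj with h | h
      · rw [h, h]
      · rw [h, ← conj_inv, h, inv_inv]
    calc c ^ 2 * t = c * (c * t * c⁻¹) * c⁻¹ * c ^ 2 := by rw [pow_two]; group
      _ = t * c ^ 2 := by rw [h2]
  have hxt : x = (c ^ 2)⁻¹ * t := by rw [← htdef, inv_mul_cancel_left]
  have hc4 : c ^ 4 = t ^ 2 := by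
    have h1 : c ^ 2 * (c ^ 2 * (x * x)) = t * t := by
      have : c ^ 2 * x = x * c ^ 2 := by
        have h3 : c ^ 2 * (c ^ 2 * x) = c ^ 2 * x * c ^ 2 := by rw [htdef, hcomm]
        exact mul_left_cancel (h3.trans (mul_assoc _ _ _))
      rw [← htdef, mul_assoc, ← mul_assoc x, ← this]
      simp only [mul_assoc]
    rw [hx, mul_one, ← pow_add, ← pow_two] at h1
    exact h1
  have ht4 : t = c ^ 8 := by
    rw [show c ^ 8 = (c ^ 4) ^ 2 by rw [← pow_mul], hc4, ← pow_mul, pow_succ t 3, ht, one_mul]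
  refine ⟨?_, ?_⟩
  · rw [show c ^ 12 = (c ^ 4) ^ 3 by rw [← pow_mul], hc4, ← pow_mul, pow_mul' t 2 3, ht, one_pow]
  · rw [hxt, ht4, inv_mul_eq_iff_eq_mul, ← pow_add]

/-- The homomorphism from a cyclic group given by the image of a generator. -/
def zmodHom {n : ℕ} [NeZero n] {c : G} (hc : c ^ n = 1) : Multiplicative (ZMod n) →* G :=
  MonoidHom.mk' (fun a => c ^ (Multiplicative.toAdd a).val) fun a b => by
    rw [toAdd_mul, ZMod.val_add, ← pow_add, ← pow_eq_pow_mod _ hc]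

/-- The homomorphism from a dihedral group given by the images of the generators. -/
theorem exists_dihedralHom {n : ℕ} [NeZero n] {R s : G} (hR : R ^ n = 1) (hs : s * s = 1)
    (hsR : s * R = R⁻¹ * s) : ∃ φ : DihedralGroup n →* G,
      (∀ k : ℕ, φ (DihedralGroup.r k) = R ^ k) ∧ ∀ k : ℕ, φ (DihedralGroup.sr k) = s * R ^ k := by
  have hval (k : ℕ) : R ^ (k : ZMod n).val = R ^ k := by
    rw [ZMod.val_natCast, ← pow_eq_pow_mod _ hR]
  have hadd (i j : ZMod n) : R ^ (i + j).val = R ^ i.val * R ^ j.val := by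
    rw [ZMod.val_add, ← pow_add, ← pow_eq_pow_mod _ hR]
  have hsub (i j : ZMod n) : R ^ (j - i).val = (R ^ i.val)⁻¹ * R ^ j.val := by
    rw [eq_inv_mul_iff_mul_eq, ← hadd, add_sub_cancel]
  have hpow (k : ℕ) : s * R ^ k = (R ^ k)⁻¹ * s := by
    rw [← inv_pow]
    exact (show SemiconjBy s R R⁻¹ from hsR).pow_right k
  have hpow' (k : ℕ) : s * (R ^ k)⁻¹ = R ^ k * s :=
    (show SemiconjBy s (R ^ k) (R ^ k)⁻¹ from hpow k).inv_right.eq.trans (by rw [inv_inv])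
  let f : DihedralGroup n → G
    | .r i => R ^ i.val
    | .sr i => s * R ^ i.val
  refine ⟨MonoidHom.mk' f ?_, hval, fun k => congrArg (s * ·) (hval k)⟩
  rintro (i | i) (j | j)
  · exact hadd i j
  · change s * R ^ (j - i).val = R ^ i.val * (s * R ^ j.val)
    rw [hsub, ← mul_assoc, hpow', mul_assoc]
  · exact (congrArg (s * ·) (hadd i j)).trans (mul_assoc _ _ _).symm
  · change R ^ (j - i).val = s * R ^ i.val * (s * R ^ j.val)
    rw [hsub, hpow, mul_assoc, ← mul_assoc s s, hs, one_mul]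

theorem alternating_four_aux : ∀ a : Equiv.Perm (Fin 4), Equiv.Perm.sign a = 1 → a * a = 1 →
    ∀ b : Equiv.Perm (Fin 4), Equiv.Perm.sign b = 1 → b * b = 1 →
    ∀ c : Equiv.Perm (Fin 4), Equiv.Perm.sign c = 1 → c * c = 1 →
    (a * b * c) ^ 3 = 1 → a * b * c = 1 := by
  decide +kernel

theorem conj_mem_zpowers_of_involutions (hG : Nat.card G = 12) {x y z : G} (hx : x * x = 1)
    (hy : y * y = 1) (hz : z * z = 1) (ht : (x * y * z) ^ 3 = 1) (ht1 : x * y * z ≠ 1) (g : G) :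
    g * (x * y * z) * g⁻¹ ∈ Subgroup.zpowers (x * y * z) := by
  have hfin : Finite G := Nat.finite_of_card_ne_zero (by simp [hG])
  set T := Subgroup.zpowers (x * y * z) with hT
  have hT3 : Nat.card T = 3 := card_zpowers_eq_three ht ht1
  have hidx : Nat.card (G ⧸ T) = 4 := by
    have := T.card_mul_index
    rw [hT3, hG, Subgroup.index] at this
    lia
  let e : G ⧸ T ≃ Fin 4 := Finite.equivFinOfCardEq hidx
  let f : G →* Equiv.Perm (Fin 4) :=
    (Equiv.permCongrHom e).toMonoidHom.comp (MulAction.toPermHom G (G ⧸ T))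
  have hker : f.ker = T.normalCore := by
    rw [Subgroup.normalCore_eq_ker]
    ext g
    simp [f, MonoidHom.mem_ker]
  have hTp : Fact (Nat.card T).Prime := ⟨by rw [hT3]; exact Nat.prime_three⟩
  have hcore : T.normalCore = ⊥ ∨ T.normalCore = T := by
    rcases (T.normalCore.subgroupOf T).eq_bot_or_eq_top_of_prime_card with h | h
    · exact Or.inl (by
        rw [Subgroup.subgroupOf_eq_bot, disjoint_iff, inf_eq_left.2 T.normalCore_le] at h
        exact h)
    · exact Or.inr (le_antisymm T.normalCore_le (Subgroup.subgroupOf_eq_top.1 h))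
  rcases hcore with h | h
  · exfalso
    rw [h, MonoidHom.ker_eq_bot_iff] at hker
    have hrange : Nat.card f.range = 12 := by
      rw [← hG, ← Nat.card_congr (MonoidHom.ofInjective hker).toEquiv]
    have hmul := f.range.card_mul_index
    rw [hrange, Nat.card_perm, Nat.card_fin] at hmul
    have halt := Equiv.Perm.eq_alternatingGroup_of_index_eq_two
      (show f.range.index = 2 by simp [Nat.factorial] at hmul; lia)
    have hsign (g : G) : Equiv.Perm.sign (f g) = 1 := by
      rw [← Equiv.Perm.mem_alternatingGroup, ← halt]
      exact ⟨g, rfl⟩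
    refine ht1 (hker ?_)
    rw [map_one, map_mul, map_mul]
    refine alternating_four_aux _ (hsign x) ?_ _ (hsign y) ?_ _ (hsign z) ?_ ?_ <;>
      simp only [← map_mul, ← map_pow, hx, hy, hz, ht, map_one]
  · have : T.Normal := h ▸ T.normalCore_normal
    exact this.conj_mem _ (Subgroup.mem_zpowers _) g

/-- An involution centralizing a normal subgroup of order three commutes with every involution. -/
theorem commute_of_commute (hG : Nat.card G = 12) (ht : t ^ 3 = 1) (ht1 : t ≠ 1)
    (hn : ∀ g : G, g * t * g⁻¹ ∈ Subgroup.zpowers t) {u s : G} (hu : u * u = 1) (hs : s * s = 1)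
    (hut : Commute u t) : Commute u s := by
  have hnormal : (Subgroup.zpowers t).Normal := by
    refine ⟨fun n hn' g => ?_⟩
    obtain ⟨k, rfl⟩ := hn'
    simp only [← conj_zpow]
    exact Subgroup.zpow_mem _ (hn g) k
  have hidx : Nat.card (G ⧸ Subgroup.zpowers t) = 2 ^ 2 := by
    have := (Subgroup.zpowers t).card_mul_index
    rw [card_zpowers_eq_three ht ht1, hG, Subgroup.index] at this
    lia
  have hp : Fact (Nat.Prime 2) := ⟨Nat.prime_two⟩
  have hmem : u * s * (u * s) ∈ Subgroup.zpowers t := by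
    have hcomm := (IsPGroup.isMulCommutative_of_card_eq_prime_sq hidx).is_comm.comm
      (u : G ⧸ Subgroup.zpowers t) s
    rw [← QuotientGroup.eq_one_iff, QuotientGroup.mk_mul, QuotientGroup.mk_mul, mul_assoc,
      ← mul_assoc (s : G ⧸ Subgroup.zpowers t), ← hcomm, ← mul_assoc, ← mul_assoc,
      ← QuotientGroup.mk_mul, hu, QuotientGroup.mk_one, one_mul, ← QuotientGroup.mk_mul, hs,
      QuotientGroup.mk_one]
  obtain ⟨k, hk⟩ := Subgroup.mem_zpowers_iff.1 hmem
  have hcube : (u * s * (u * s)) ^ 3 = 1 := by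
    rw [← hk, ← zpow_natCast, ← zpow_mul, mul_comm, zpow_mul, zpow_natCast, ht, one_zpow]
  have hinv : u * (s * (u * s)) = s * (u * (s * u)) := by
    have hcu : u * (u * s * (u * s)) = u * s * (u * s) * u := by
      rw [← hk]
      exact hut.zpow_right k
    have hu' (g : G) : u * (u * g) = g := by rw [← mul_assoc, hu, one_mul]
    apply mul_left_cancel (a := u)
    simpa only [mul_assoc] using hcu
  have hsq : u * s * (u * s) * (u * s * (u * s)) = 1 := by
    have hu' (g : G) : u * (u * g) = g := by rw [← mul_assoc, hu, one_mul]
    have hs' (g : G) : s * (s * g) = g := by rw [← mul_assoc, hs, one_mul]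
    nth_rw 2 [mul_assoc]
    rw [hinv]
    simp only [mul_assoc, hs', hu', hs]
  have hone : u * s * (u * s) = 1 := by rwa [pow_succ, pow_two, hsq, one_mul] at hcube
  refine (eq_inv_of_mul_eq_one_left hone).trans ?_
  rw [mul_inv_rev, inv_eq_of_mul_eq_one_left hu, inv_eq_of_mul_eq_one_left hs]

theorem exists_dihedralHom_of_involutions (hG : Nat.card G = 12) {x y z : G} (hx : x * x = 1)
    (hy : y * y = 1) (hz : z * z = 1) (ht : (x * y * z) ^ 3 = 1) (ht1 : x * y * z ≠ 1) :
    ∃ φ : DihedralGroup 6 →* G, φ (.r 4) = x * y * z ∧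
      ((φ (.r 3) = x ∧ φ (.sr 0) = y) ∨ (φ (.sr 0) = x ∧ φ (.r 3) = y) ∨
        (φ (.sr 0) = x ∧ φ (.sr 1) = y)) := by
  have hn := conj_mem_zpowers_of_involutions hG hx hy hz ht ht1
  have hor := conj_eq_or_of_zpowers_normal ht ht1 hn
  have hxy : z = y * x * (x * y * z) := by
    rw [mul_assoc x y z, mul_assoc y x, ← mul_assoc x x, hx, one_mul, ← mul_assoc, hy, one_mul]
  generalize htdef : x * y * z = t at *
  have hpow {u : G} (hu : u * u = 1) (hut : Commute t u) :
      (t * u) ^ 3 = u ∧ (t * u) ^ 4 = t ∧ (t * u) ^ 6 = 1 := by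
    have h3 : (t * u) ^ 3 = u := by rw [hut.mul_pow, ht, one_mul, pow_succ, pow_two, hu, one_mul]
    refine ⟨h3, ?_, ?_⟩
    · rw [pow_succ', h3, mul_assoc, hu, mul_one]
    · rw [show (t * u) ^ 6 = ((t * u) ^ 3) ^ 2 by rw [← pow_mul], h3, pow_two, hu]
  have hhom {u s : G} (hu : u * u = 1) (hs : s * s = 1) (hut : Commute u t)
      (hst : s * t * s⁻¹ = t⁻¹) : ∃ φ : DihedralGroup 6 →* G, φ (.r 4) = t ∧ φ (.r 3) = u ∧
      φ (.sr 0) = s ∧ φ (.sr 1) = s * (t * u) := by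
    obtain ⟨h3, h4, h6⟩ := hpow hu hut.symm
    have hus := commute_of_commute hG ht ht1 hn hu hs hut
    obtain ⟨φ, hr, hsr⟩ := exists_dihedralHom h6 hs (by
      rw [mul_inv_rev, inv_eq_of_mul_eq_one_left hu, ← mul_assoc, mul_inv_eq_iff_eq_mul.1 hst,
        mul_assoc, ← hus.eq, ← mul_assoc, hut.inv_right.eq])
    refine ⟨φ, (hr 4).trans h4, (hr 3).trans h3, ?_, ?_⟩
    · simpa using hsr 0
    · simpa using hsr 1
  have hcomm {g : G} (h : g * t * g⁻¹ = t) : Commute g t := mul_inv_eq_iff_eq_mul.1 h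
  rcases hor x with hxt | hxt <;> rcases hor y with hyt | hyt
  · exfalso
    have hzt : Commute z t := by
      rw [hxy]
      exact ((hcomm hyt).mul_left (hcomm hxt)).mul_left (Commute.refl t)
    have hxy' := commute_of_commute hG ht ht1 hn hx hy (hcomm hxt)
    have : t * t = 1 := by
      rw [← htdef]
      have hxz := commute_of_commute hG ht ht1 hn hx hz (hcomm hxt)
      have hyz := commute_of_commute hG ht ht1 hn hy hz (hcomm hyt)
      have := (hxz.mul_left hyz).mul_mul_mul_comm
      rw [(hxz.mul_left hyz).symm.mul_mul_mul_comm, hxy'.symm.mul_mul_mul_comm, hx, hy, hz, one_mul,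
        one_mul]
    exact ht1 (by rwa [pow_succ, pow_two, this, one_mul] at ht)
  · obtain ⟨φ, h4, h3, h0, -⟩ := hhom hx hy (hcomm hxt) hyt
    exact ⟨φ, h4, Or.inl ⟨h3, h0⟩⟩
  · obtain ⟨φ, h4, h3, h0, -⟩ := hhom hy hx (hcomm hyt) hxt
    exact ⟨φ, h4, Or.inr (Or.inl ⟨h0, h3⟩)⟩
  · have hyxt : Commute (y * x) t := by
      apply hcomm
      rw [mul_inv_rev, show y * x * t * (x⁻¹ * y⁻¹) = y * (x * t * x⁻¹) * y⁻¹ by group, hxt,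
        ← conj_inv, hyt, inv_inv]
    have hzt : Commute z t := by
      rw [hxy]
      exact hyxt.mul_left (Commute.refl t)
    obtain ⟨φ, h4, -, h0, h1⟩ := hhom hz hx hzt hxt
    refine ⟨φ, h4, Or.inr (Or.inr ⟨h0, h1.trans ?_⟩)⟩
    rw [← htdef, mul_assoc (x * y), hz, mul_one, ← mul_assoc, hx, one_mul]

end GroupsOfOrderTwelve

namespace VoltagePairing.IsTriangulation

variable {G : Type} [Group G]

theorem exists_index_eq_two {D : VoltagePairing G} (h : D.IsTriangulation)
    (hf : ∃ i, D.flip i = false) : ∃ H : Subgroup G, H.index = 2 := by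
  obtain ⟨κ, hκ⟩ := h.orient
  obtain ⟨i, hi⟩ := hf
  have hor : ∀ g, (∀ b, κ (b * g) ↔ κ b) ∨ ∀ b, κ (b * g) ↔ ¬ κ b := by
    refine h.induction _ (Or.inl fun b => by rw [mul_one]) fun g j hg => ?_
    simp only [← mul_assoc, hκ]
    cases D.flip j
    · rcases hg with hg | hg
      · exact Or.inr fun b => not_congr (hg b)
      · exact Or.inl fun b => (not_congr (hg b)).trans not_not
    · exact hg
  let H : Subgroup G :=
    { carrier := {g | ∀ b, κ (b * g) ↔ κ b}
      one_mem' := fun b => by rw [mul_one]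
      mul_mem' := fun {x y} hx hy b => by rw [← mul_assoc, hy, hx]
      inv_mem' := fun {x} hx b => by rw [← hx, inv_mul_cancel_right] }
  have hvolt (b : G) : κ (b * D.volt i) ↔ ¬ κ b := by simpa [hi] using hκ b i
  refine ⟨H, Subgroup.index_eq_two_iff_exists_notMem_and.2 ⟨D.volt i, fun hmem => ?_, fun b => ?_⟩⟩
  · exact iff_not_self ((hmem 1).symm.trans (hvolt 1))
  · rcases hor b with hb | hb
    · exact Or.inr hb
    · exact Or.inl fun a => by rw [← mul_assoc, hvolt, hb, not_not]

section

variable {D : VoltagePairing G} {P : DartPairing} (h : D.IsTriangulation)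
  (hP : D.toDartPairing = P)
include h hP

theorem volt_mul_volt_mul_volt {i j k : Fin 7} (hl : ∃ l : Corner, l.s1.1 = i ∧
    (P.s0 l.s1).s1.1 = j ∧ (P.s0 (P.s0 l.s1).s1).s1.1 = k) :
    D.volt i * D.volt j * D.volt k = 1 := by
  obtain ⟨l, rfl, rfl, rfl⟩ := hl
  subst hP
  simpa [VoltagePairing.s0, s1] using congrArg Prod.fst (h.face (1, l))

theorem volt_mul_volt {i j : Fin 7} (hij : P.pair i = j) : D.volt i * D.volt j = 1 := by
  subst hP hij
  simpa [VoltagePairing.s0, DartPairing.s0] using congrArg Prod.fst (h.s0_s0 (1, i, false))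

theorem volt_ne_one {i : Fin 7} (hl : ∃ l : Corner, l.s1.1 = i ∧ P.s0 l.s1 = l) :
    D.volt i ≠ 1 := by
  obtain ⟨l, rfl, hl⟩ := hl
  subst hP
  exact fun h1 => h.face_ne (1, l) (Prod.ext (by simp [VoltagePairing.s0, s1, h1]) hl)

end

theorem map_eq_of_mul_eq_one {A : Type} [Group A] {φ : A →* G} {a b : A} {x y : G}
    (hab : a * b = 1) (hxy : x * y = 1) (h : φ a = x) : φ b = y := by
  rw [eq_inv_of_mul_eq_one_right hab, map_inv, h, inv_eq_of_mul_eq_one_right hxy]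

theorem map_mul_eq {A : Type} [Group A] {φ : A →* G} {a b : A} {x y : G} (ha : φ a = x)
    (hb : φ b = y) : φ (a * b) = x * y := by
  rw [map_mul, ha, hb]

theorem exists_hom_cyclicOne {D : VoltagePairing G} (h : D.IsTriangulation)
    (hP : D.toDartPairing = cyclicOne.toDartPairing) :
    ∃ φ : Multiplicative (ZMod 12) →* G, ∀ i, φ (cyclicOne.volt i) = D.volt i := by
  obtain ⟨H, hH⟩ := h.exists_index_eq_two ⟨4, by rw [hP]; rfl⟩
  have r301 : D.volt 3 * D.volt 0 * D.volt 1 = 1 := h.volt_mul_volt_mul_volt hP (by decide)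
  have r222 : D.volt 2 * D.volt 2 * D.volt 2 = 1 := h.volt_mul_volt_mul_volt hP (by decide)
  have r446 : D.volt 4 * D.volt 4 * D.volt 6 = 1 := h.volt_mul_volt_mul_volt hP (by decide)
  have r00 : D.volt 0 * D.volt 0 = 1 := h.volt_mul_volt hP (by decide)
  have r12 : D.volt 1 * D.volt 2 = 1 := h.volt_mul_volt hP (by decide)
  have r21 : D.volt 2 * D.volt 1 = 1 := h.volt_mul_volt hP (by decide)
  have r36 : D.volt 3 * D.volt 6 = 1 := h.volt_mul_volt hP (by decide)
  have r63 : D.volt 6 * D.volt 3 = 1 := h.volt_mul_volt hP (by decide)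
  have r45 : D.volt 4 * D.volt 5 = 1 := h.volt_mul_volt hP (by decide)
  have e2 : D.volt 2 = D.volt 4 ^ 2 * D.volt 0 := by
    rw [mul_right_cancel (r21.trans r301.symm), mul_right_cancel (r36.trans r446.symm), pow_two]
  obtain ⟨hc, h0⟩ := eq_pow_six_of_index_eq_two h.card hH r00
    (by rw [← e2, pow_succ, pow_two, r222]) (by rw [← e2]; exact h.volt_ne_one hP (by decide))
  have h0 : zmodHom hc (cyclicOne.volt 0) = D.volt 0 := h0.symm
  have h4 : zmodHom hc (cyclicOne.volt 4) = D.volt 4 := pow_one _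
  have h5 : zmodHom hc (cyclicOne.volt 5) = D.volt 5 := map_eq_of_mul_eq_one (by decide) r45 h4
  have h6 : zmodHom hc (cyclicOne.volt 6) = D.volt 6 :=
    map_eq_of_mul_eq_one (by decide) r446 (map_mul_eq h4 h4)
  have h3 : zmodHom hc (cyclicOne.volt 3) = D.volt 3 := map_eq_of_mul_eq_one (by decide) r63 h6
  have h1 : zmodHom hc (cyclicOne.volt 1) = D.volt 1 :=
    map_eq_of_mul_eq_one (by decide) r301 (map_mul_eq h3 h0)
  have h2 : zmodHom hc (cyclicOne.volt 2) = D.volt 2 := map_eq_of_mul_eq_one (by decide) r12 h1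
  refine ⟨zmodHom hc, fun i => ?_⟩
  fin_cases i
  exacts [h0, h1, h2, h3, h4, h5, h6]

theorem exists_hom_cyclicTwo {D : VoltagePairing G} (h : D.IsTriangulation)
    (hP : D.toDartPairing = cyclicTwo.toDartPairing) :
    ∃ φ : Multiplicative (ZMod 12) →* G, ∀ i, φ (cyclicTwo.volt i) = D.volt i := by
  obtain ⟨H, hH⟩ := h.exists_index_eq_two ⟨1, by rw [hP]; rfl⟩
  have r012 : D.volt 0 * D.volt 1 * D.volt 2 = 1 := h.volt_mul_volt_mul_volt hP (by decide)
  have r555 : D.volt 5 * D.volt 5 * D.volt 5 = 1 := h.volt_mul_volt_mul_volt hP (by decide)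
  have r614 : D.volt 6 * D.volt 1 * D.volt 4 = 1 := h.volt_mul_volt_mul_volt hP (by decide)
  have r00 : D.volt 0 * D.volt 0 = 1 := h.volt_mul_volt hP (by decide)
  have r13 : D.volt 1 * D.volt 3 = 1 := h.volt_mul_volt hP (by decide)
  have r26 : D.volt 2 * D.volt 6 = 1 := h.volt_mul_volt hP (by decide)
  have r62 : D.volt 6 * D.volt 2 = 1 := h.volt_mul_volt hP (by decide)
  have r45 : D.volt 4 * D.volt 5 = 1 := h.volt_mul_volt hP (by decide)
  have r54 : D.volt 5 * D.volt 4 = 1 := h.volt_mul_volt hP (by decide)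
  have e5 : D.volt 5 = D.volt 0 * (D.volt 1 ^ 2 * D.volt 0) * (D.volt 0)⁻¹ := by
    rw [mul_assoc, mul_inv_cancel_right, mul_right_cancel (r54.trans r614.symm),
      mul_right_cancel (r62.trans r012.symm), mul_assoc, pow_two]
  obtain ⟨hc, h0⟩ := eq_pow_six_of_index_eq_two h.card hH (c := D.volt 1) r00
    (by rw [← conj_eq_one_iff, ← conj_pow, ← e5, pow_succ, pow_two, r555])
    (by rw [← conj_eq_one_iff.ne, ← e5]; exact h.volt_ne_one hP (by decide))
  have h0 : zmodHom hc (cyclicTwo.volt 0) = D.volt 0 := h0.symm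
  have h1 : zmodHom hc (cyclicTwo.volt 1) = D.volt 1 := pow_one _
  have h3 : zmodHom hc (cyclicTwo.volt 3) = D.volt 3 := map_eq_of_mul_eq_one (by decide) r13 h1
  have h2 : zmodHom hc (cyclicTwo.volt 2) = D.volt 2 :=
    map_eq_of_mul_eq_one (by decide) r012 (map_mul_eq h0 h1)
  have h6 : zmodHom hc (cyclicTwo.volt 6) = D.volt 6 := map_eq_of_mul_eq_one (by decide) r26 h2
  have h4 : zmodHom hc (cyclicTwo.volt 4) = D.volt 4 :=
    map_eq_of_mul_eq_one (by decide) r614 (map_mul_eq h6 h1)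
  have h5 : zmodHom hc (cyclicTwo.volt 5) = D.volt 5 := map_eq_of_mul_eq_one (by decide) r45 h4
  refine ⟨zmodHom hc, fun i => ?_⟩
  fin_cases i
  exacts [h0, h1, h2, h3, h4, h5, h6]

theorem exists_hom_dihedral {D : VoltagePairing G} (h : D.IsTriangulation)
    (hP : D.toDartPairing = dihedralPairing) : ∃ φ : DihedralGroup 6 →* G,
      (∀ i, φ (dihedralOne.volt i) = D.volt i) ∨ (∀ i, φ (dihedralTwo.volt i) = D.volt i) ∨
        ∀ i, φ (dihedralThree.volt i) = D.volt i := by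
  have r012 : D.volt 0 * D.volt 1 * D.volt 2 = 1 := h.volt_mul_volt_mul_volt hP (by decide)
  have r634 : D.volt 6 * D.volt 3 * D.volt 4 = 1 := h.volt_mul_volt_mul_volt hP (by decide)
  have r463 : D.volt 4 * D.volt 6 * D.volt 3 = 1 := h.volt_mul_volt_mul_volt hP (by decide)
  have r555 : D.volt 5 * D.volt 5 * D.volt 5 = 1 := h.volt_mul_volt_mul_volt hP (by decide)
  have r00 : D.volt 0 * D.volt 0 = 1 := h.volt_mul_volt hP (by decide)
  have r11 : D.volt 1 * D.volt 1 = 1 := h.volt_mul_volt hP (by decide)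
  have r33 : D.volt 3 * D.volt 3 = 1 := h.volt_mul_volt hP (by decide)
  have r26 : D.volt 2 * D.volt 6 = 1 := h.volt_mul_volt hP (by decide)
  have r62 : D.volt 6 * D.volt 2 = 1 := h.volt_mul_volt hP (by decide)
  have r54 : D.volt 5 * D.volt 4 = 1 := h.volt_mul_volt hP (by decide)
  have e5 : D.volt 5 = D.volt 0 * D.volt 1 * D.volt 3 := by
    rw [mul_right_cancel (r54.trans r634.symm), mul_right_cancel (r62.trans r012.symm)]
  obtain ⟨φ, h5, hφ⟩ := exists_dihedralHom_of_involutions h.card r00 r11 r33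
    (by rw [← e5, pow_succ, pow_two, r555]) (by rw [← e5]; exact h.volt_ne_one hP (by decide))
  rw [← e5] at h5
  have key (v : Fin 7 → DihedralGroup 6) (v012 : v 0 * v 1 * v 2 = 1) (v26 : v 2 * v 6 = 1)
      (v5 : v 5 = .r 4) (v54 : v 5 * v 4 = 1) (v463 : v 4 * v 6 * v 3 = 1)
      (h0 : φ (v 0) = D.volt 0) (h1 : φ (v 1) = D.volt 1) (i : Fin 7) : φ (v i) = D.volt i := by
    rw [← v5] at h5
    have h2 := map_eq_of_mul_eq_one v012 r012 (map_mul_eq h0 h1)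
    have h6 := map_eq_of_mul_eq_one v26 r26 h2
    have h4 := map_eq_of_mul_eq_one v54 r54 h5
    have h3 := map_eq_of_mul_eq_one v463 r463 (map_mul_eq h4 h6)
    fin_cases i
    exacts [h0, h1, h2, h3, h4, h5, h6]
  refine ⟨φ, hφ.imp (fun ⟨h0, h1⟩ => ?_) (Or.imp (fun ⟨h0, h1⟩ => ?_) fun ⟨h0, h1⟩ => ?_)⟩
  · exact key dihedralOne.volt (by decide) (by decide) rfl (by decide) (by decide) h0 h1
  · exact key dihedralTwo.volt (by decide) (by decide) rfl (by decide) (by decide) h0 h1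
  · exact key dihedralThree.volt (by decide) (by decide) rfl (by decide) (by decide) h0 h1

end VoltagePairing.IsTriangulation

namespace CMap

open VoltagePairing

variable {F : Type} [Fintype F] {M : CMap F}

theorem IsDerived.exists_isomorphic {G : Type} [Group G] {D : VoltagePairing G}
    {e : F ≃ G × Corner} (h : M.IsDerived D e) (hD : D.IsTriangulation)
    (hn : D.toDartPairing.IsNormal) : ∃ i, M.Isomorphic (theMap i) := by
  have hcard : Nat.card (Fin 168) = 168 := Nat.card_fin 168
  rcases hn with ⟨hp, hf⟩ | ⟨hp, hf⟩ | ⟨hp, hf⟩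
  · have hP : D.toDartPairing = cyclicOne.toDartPairing := DartPairing.ext hp hf
    obtain ⟨φ, hφ⟩ := hD.exists_hom_cyclicOne hP
    exact ⟨0, h.isomorphic hD isAdmissible_cyclicOne _ hcard hP φ hφ⟩
  · have hP : D.toDartPairing = cyclicTwo.toDartPairing := DartPairing.ext hp hf
    obtain ⟨φ, hφ⟩ := hD.exists_hom_cyclicTwo hP
    exact ⟨1, h.isomorphic hD isAdmissible_cyclicTwo _ hcard hP φ hφ⟩
  · have hP : D.toDartPairing = dihedralPairing := DartPairing.ext hp hf
    obtain ⟨φ, hφ | hφ | hφ⟩ := hD.exists_hom_dihedral hP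
    · exact ⟨2, h.isomorphic hD isAdmissible_dihedralOne _ hcard hP φ hφ⟩
    · exact ⟨3, h.isomorphic hD isAdmissible_dihedralTwo _ hcard hP φ hφ⟩
    · exact ⟨4, h.isomorphic hD isAdmissible_dihedralThree _ hcard hP φ hφ⟩

theorem exists_isomorphic_theMap (h : GoodMap M) (hor : M.Orientable) :
    ∃ i, M.Isomorphic (theMap i) := by
  obtain ⟨hT, hE, hχ, hR, hC⟩ := h
  obtain ⟨O, hO⟩ : ∃ O, M.IsOrientation O := hor
  have hcard := (euler_eq_neg_two_iff hO hE).1 hχ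
  obtain ⟨hF, hV⟩ := (equivelar_iff hO).1 hE
  have h7 (x : F) : M.rot^[7] x = x := by
    rw [← hV x]
    exact Function.iterate_minimalPeriod
  have h3 (x : F) : M.s0 (M.s1 (M.s0 (M.s1 (M.s0 (M.s1 x))))) = x := by
    have := Function.iterate_minimalPeriod (f := M.s0 * M.s1) (x := x)
    rwa [hF x] at this
  have hne (x : F) : M.s0 (M.s1 x) ≠ x := fun hx => by
    have := Function.minimalPeriod_eq_one_iff_isFixedPt.2
      (show Function.IsFixedPt (M.s0 * M.s1) x from hx)
    rw [hF x] at this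
    lia
  obtain ⟨A, hA, htrans, hfree⟩ := exists_regular_subgroup hO h7 hT
    (flagOrbit_rot_ne h7 h3 hT hR hC)
  obtain ⟨D, e, hD⟩ := exists_isDerived hE h7 hA htrans hfree
  obtain ⟨l, m, hlm⟩ := (hD.isTriangulation hO h3 hne hcard).isTriangular.exists_isNormal
  have hD' := (hD.rebase l).rebase m
  exact hD'.exists_isomorphic (hD'.isTriangulation hO h3 hne hcard) hlm

end CMap

/-- Up to isomorphism there are exactly `5` orientable
vertex-transitive equivelar maps of Schläfli type `{3, 7}` with Euler
characteristic `-2` that are neither regular nor chiral. -/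
theorem stmt_17 :
    ∃ Ms : Fin 5 → CMap (Fin 168),
      (∀ i, GoodMap (Ms i) ∧ (Ms i).Orientable) ∧
      (∀ i j, (Ms i).Isomorphic (Ms j) → i = j) ∧
      (∀ (F : Type) [Fintype F] (M : CMap F), GoodMap M → M.Orientable →
        ∃ i, M.Isomorphic (Ms i)) :=
  ⟨CMap.theMap, CMap.goodMap_theMap, CMap.eq_of_isomorphic_theMap,
    fun _ _ _ hM hO => CMap.exists_isomorphic_theMap hM hO⟩
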